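/- The images under the quotient map ℂ[M_{k,2n}] → ℂ[M_{k,2n}]/I of the N-standard monomials Δ(t), as t ranges over all N-standard tableaux in D(N) (including the empty one), form a ℂ-vector space basis of R(N_{k,2n}) = ℂ[M_{k,2n}]/I. -/

import Mathlib

noncomputable section

/-- One-line tableau predicate: `isTab n m I J` says `[I:J]` is a one-line tableau in `D(n,m)`,
i.e. `I ⊆ {1,…,n}` and `J ⊆ {1,…,m}` are strictly increasing sequences of the same (positive) length. -/
def isTab (n m : ℕ) (I J : List ℕ) : Prop :=
  I.length = J.length ∧ I ≠ [] ∧ I.Chain' (· < ·) ∧ J.Chain' (· < ·) ∧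
    (∀ x ∈ I, 1 ≤ x ∧ x ≤ n) ∧ ∀ x ∈ J, 1 ≤ x ∧ x ≤ m

/-- The tableau order `A ⪯ B` on one-line tableaux. -/
def tleq (A B : List ℕ × List ℕ) : Prop :=
  B.1.length ≤ A.1.length ∧
    ∀ r < B.1.length, A.1.getD r 0 ≤ B.1.getD r 0 ∧ A.2.getD r 0 ≤ B.2.getD r 0

/-- `dmin n m I J` is the minor δ_{[I:J]} ∈ ℂ[M_{n,m}] : the determinant of the submatrix of
the generic n×m matrix of variables with rows `I` and columns `J` (1-based indices). -/
def dmin (n m : ℕ) (I J : List ℕ) : MvPolynomial (Fin n × Fin m) ℂ :=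
  Matrix.det (Matrix.of fun a b : Fin I.length =>
    if h : I.getD a 0 - 1 < n ∧ J.getD b 0 - 1 < m then
      MvPolynomial.X (⟨I.getD a 0 - 1, h.1⟩, ⟨J.getD b 0 - 1, h.2⟩)
    else 0)

/-- The basic symplectic invariant `r_{ij} = ∑_u (x_{i,2u−1}x_{j,2u} − x_{j,2u−1}x_{i,2u})`
(with 0-based variable indices). -/
def rbase (k n : ℕ) (i j : Fin k) : MvPolynomial (Fin k × Fin (2 * n)) ℂ :=
  ∑ u : Fin n,
    (MvPolynomial.X (i, ⟨2 * u.1, by have := u.isLt; omega⟩) *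
        MvPolynomial.X (j, ⟨2 * u.1 + 1, by have := u.isLt; omega⟩) -
      MvPolynomial.X (j, ⟨2 * u.1, by have := u.isLt; omega⟩) *
        MvPolynomial.X (i, ⟨2 * u.1 + 1, by have := u.isLt; omega⟩))

/-- The ideal `I` of the nullcone, generated by the basic symplectic invariants. -/
def sympIdeal (k n : ℕ) : Ideal (MvPolynomial (Fin k × Fin (2 * n)) ℂ) :=
  Ideal.span {f | ∃ i j : Fin k, i < j ∧ f = rbase k n i j}

/-- `Jtilde n J` means `J ⪰ J̃ = [1,3,…,2n−1]`, i.e. `ℓ(J) ≤ n` and the `r`-th entry of `J`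
is at least `2r−1` (0-based: entry at index r is ≥ 2r+1). -/
def Jtilde (n : ℕ) (J : List ℕ) : Prop :=
  J.length ≤ n ∧ ∀ r < J.length, 2 * r + 1 ≤ J.getD r 0

/-- `D(𝒩)` : one-line tableaux `[I:J] ∈ D(k,2n)` with `ℓ([I:J]) ≤ min(k,n)` and `J ⪰ J̃`. -/
def isTabN (k n : ℕ) (I J : List ℕ) : Prop :=
  isTab k (2 * n) I J ∧ I.length ≤ min k n ∧ Jtilde n J

/-- The standard symplectic pairing of two coordinate sequences of length `2 * n`. -/
def sympPairing {S : Type*} [CommRing S] (n : ℕ) (f g : ℕ → S) : S :=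
  ∑ u ∈ Finset.range n, (f (2 * u) * g (2 * u + 1) - g (2 * u) * f (2 * u + 1))

lemma sympPairing_add_single {S : Type*} [CommRing S] {n t : ℕ} (ht : t < n) (f g : ℕ → S)
    (c : S) :
    sympPairing n f (g + Pi.single (2 * t + 1) c) = sympPairing n f g + f (2 * t) * c := by
  unfold sympPairing
  rw [← sub_eq_iff_eq_add', ← Finset.sum_sub_distrib,
    Finset.sum_eq_single_of_mem t (Finset.mem_range.2 ht)]
  · have h : (2 * t : ℕ) ≠ 2 * t + 1 := by omega
    simp
    ring
  · intro u _ hu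
    have h1 : (2 * u : ℕ) ≠ 2 * t + 1 := by omega
    have h2 : (2 * u + 1 : ℕ) ≠ 2 * t + 1 := by omega
    simp only [Pi.add_apply, Pi.single_eq_of_ne h1, Pi.single_eq_of_ne h2]
    ring

lemma sympPairing_swap {S : Type*} [CommRing S] (n : ℕ) (f g : ℕ → S) :
    sympPairing n g f = - sympPairing n f g := by
  unfold sympPairing
  rw [← Finset.sum_neg_distrib]
  exact Finset.sum_congr rfl fun u _ => by ring

/-- There are pairwise orthogonal vectors whose `r`-th member has coordinate `1` at `2 * r` and
arbitrarily prescribed coordinates after `2 * r`. -/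
lemma exists_isotropic {S : Type*} [CommRing S] (n : ℕ) (q : ℕ → ℕ → S) :
    ∃ N : ℕ → ℕ → S, (∀ r < n, N r (2 * r) = 1) ∧ (∀ r < n, ∀ j, 2 * r < j → N r j = q r j) ∧
      ∀ r < n, ∀ s < n, sympPairing n (N r) (N s) = 0 := by
  set v : ℕ → ℕ → S := fun r j => if j < 2 * r then 0 else if j = 2 * r then 1 else q r j with hv
  have key : ∀ r < n, ∀ d ≤ r, ∃ g : ℕ → S, (∀ j, (2 * r ≤ j ∨ Even j) → g j = v r j) ∧
      ∀ s < r, r ≤ s + d → sympPairing n (v s) g = 0 := by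
    intro r hr d
    induction d with
    | zero => exact fun _ => ⟨v r, fun _ _ => rfl, fun s hs h => by omega⟩
    | succ d ih =>
      intro hd
      obtain ⟨g, hg, hg'⟩ := ih (by omega)
      obtain ⟨t, ht⟩ : ∃ t, r = t + d + 1 := ⟨r - d - 1, by omega⟩
      refine ⟨g + Pi.single (2 * t + 1) (- sympPairing n (v t) g), fun j hj => ?_,
        fun s hs h => ?_⟩
      · have : j ≠ 2 * t + 1 := by
          rintro rfl
          rcases hj with hj | hj
          · omega
          · rw [Nat.even_iff] at hj; omega
        simp [Pi.single_eq_of_ne this, hg j hj]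
      · rw [sympPairing_add_single (by omega)]
        rcases Nat.eq_or_lt_of_le (show t ≤ s by omega) with rfl | hts
        · simp [hv]
        · rw [hg' s hs (by omega)]
          simp [hv, show 2 * t < 2 * s by omega]
  choose! N hN using fun r (hr : r < n) => key r hr r le_rfl
  have hlt : ∀ s r, s < r → r < n → sympPairing n (N s) (N r) = 0 := by
    intro s r hsr hr
    rw [← (hN r hr).2 s hsr (by omega)]
    refine Finset.sum_congr rfl fun u _ => ?_
    rw [(hN s (by omega)).1 (2 * u) (Or.inr (even_two_mul u))]
    congr 1
    by_cases h : 2 * s ≤ 2 * u + 1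
    · rw [(hN s (by omega)).1 (2 * u + 1) (Or.inl h)]
    · rw [(hN r hr).1 (2 * u) (Or.inr (even_two_mul u))]
      simp [hv, show u < r by omega]
  refine ⟨N, fun r hr => ?_, fun r hr j hj => ?_, fun r hr s hs => ?_⟩
  · rw [(hN r hr).1 _ (Or.inl le_rfl)]; simp [hv]
  · rw [(hN r hr).1 _ (Or.inl hj.le)]
    simp [hv, show ¬ j < 2 * r by omega, show j ≠ 2 * r by omega]
  · rcases lt_trichotomy r s with h | rfl | h
    · exact hlt r s h hs
    · exact Finset.sum_eq_zero fun u _ => by ring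
    · rw [sympPairing_swap, hlt s r h hr, neg_zero]

lemma coe_toLex_sum {σ ι : Type*} (f : ι → σ →₀ ℕ) (C : Finset ι) :
    ((toLex (∑ r ∈ C, f r) : Lex (σ →₀ ℕ)) : WithTop (Lex (σ →₀ ℕ))) =
      ∑ r ∈ C, ((toLex (f r) : Lex (σ →₀ ℕ)) : WithTop _) := by
  classical
  induction C using Finset.induction_on with
  | empty => simp
  | insert a s ha ih =>
    rw [Finset.sum_insert ha, Finset.sum_insert ha, ← ih]
    rfl

section LexOrder

open MvPowerSeries

variable {σ : Type*} [LinearOrder σ]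

lemma toLex_lt_single {x : σ} {e : σ →₀ ℕ} (h : ∀ y ∈ e.support, x < y) :
    toLex e < toLex (Finsupp.single x 1) := by
  refine ⟨x, fun y hy => ?_, ?_⟩
  · have : e y = 0 := by
      by_contra h'
      exact lt_asymm hy (h y (Finsupp.mem_support_iff.2 h'))
    simp [this, hy.ne]
  · have : e x = 0 := by
      by_contra h'
      exact lt_irrefl _ (h x (Finsupp.mem_support_iff.2 h'))
    simp [this]

lemma toLex_sum_lt_sum {ι : Type*} [Fintype ι] [DecidableEq ι] (f : ι → σ →₀ ℕ)
    (g : ι → WithTop (Lex (σ →₀ ℕ))) (C : Finset ι)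
    (hC : ∀ r ∈ C, ((toLex (f r) : Lex (σ →₀ ℕ)) : WithTop _) ≤ g r) {r₁ : ι} (hr₁ : r₁ ∉ C) {x : σ}
    (hx : ((toLex (Finsupp.single x 1) : Lex (σ →₀ ℕ)) : WithTop (Lex (σ →₀ ℕ))) ≤ g r₁)
    (hf : ∀ r ∉ C, ∀ y ∈ (f r).support, x < y) :
    ((toLex (∑ r, f r) : Lex (σ →₀ ℕ)) : WithTop _) < ∑ r, g r := by
  rw [← Finset.sum_add_sum_compl C f, ← Finset.sum_add_sum_compl C g]
  have h1 : ((toLex (∑ r ∈ C, f r) : Lex (σ →₀ ℕ)) : WithTop _) ≤ ∑ r ∈ C, g r := by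
    rw [coe_toLex_sum]
    exact Finset.sum_le_sum hC
  have h2 : ((toLex (∑ r ∈ Cᶜ, f r) : Lex (σ →₀ ℕ)) : WithTop _) <
      ((toLex (Finsupp.single x 1) : Lex (σ →₀ ℕ)) : WithTop (Lex (σ →₀ ℕ))) := by
    refine WithTop.coe_lt_coe.2 (toLex_lt_single fun y hy => ?_)
    obtain ⟨r, hr, hy⟩ := Finset.mem_biUnion.1 (Finsupp.support_finsetSum hy)
    exact hf r (Finset.mem_compl.1 hr) y hy
  have h3 : ((toLex (Finsupp.single x 1) : Lex (σ →₀ ℕ)) : WithTop (Lex (σ →₀ ℕ))) ≤ ∑ r ∈ Cᶜ, g r :=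
    hx.trans (Finset.single_le_sum (f := g) (fun _ _ => bot_le) (Finset.mem_compl.2 hr₁))
  rw [toLex_add, WithTop.coe_add]
  refine lt_of_lt_of_le ?_ (add_le_add h1 h3)
  rw [← WithTop.coe_add, ← WithTop.coe_add, WithTop.coe_lt_coe]
  exact add_lt_add_right (WithTop.coe_lt_coe.1 h2) _

variable [WellFoundedGT σ]

lemma lexOrder_one_eq : lexOrder (1 : MvPowerSeries σ ℂ) = 0 := by
  apply le_antisymm
  · exact lexOrder_le_of_coeff_ne_zero (d := 0) (by simp)
  · exact bot_le

lemma lexOrder_prod {ι : Type*} (s : Finset ι) (f : ι → MvPowerSeries σ ℂ) :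
    lexOrder (∏ i ∈ s, f i) = ∑ i ∈ s, lexOrder (f i) := by
  classical
  induction s using Finset.induction_on with
  | empty => simp [lexOrder_one_eq]
  | insert a s ha ih => rw [Finset.prod_insert ha, Finset.sum_insert ha, lexOrder_mul, ih]

lemma lexOrder_neg_eq (f : MvPowerSeries σ ℂ) : lexOrder (-f) = lexOrder f := by
  have : lexOrder (-1 : MvPowerSeries σ ℂ) = 0 := by
    apply le_antisymm
    · exact lexOrder_le_of_coeff_ne_zero (d := 0) (by simp)
    · exact bot_le
  rw [neg_eq_neg_one_mul, lexOrder_mul, this, zero_add]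

lemma lexOrder_X_eq (x : σ) :
    lexOrder (X x : MvPowerSeries σ ℂ) = (toLex (Finsupp.single x 1) : Lex (σ →₀ ℕ)) := by
  classical
  apply le_antisymm
  · exact lexOrder_le_of_coeff_ne_zero (by simp [coeff_X])
  · rw [le_lexOrder_iff]
    intro d hd
    rw [coeff_X, if_neg]
    rintro rfl
    exact lt_irrefl _ hd

lemma lexOrder_sum_eq {ι : Type*} [Fintype ι] [DecidableEq ι] (f : ι → MvPowerSeries σ ℂ) (i₀ : ι)
    (m : Lex (σ →₀ ℕ)) (h0 : lexOrder (f i₀) = m) (h : ∀ i ≠ i₀, (m : WithTop _) < lexOrder (f i)) :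
    lexOrder (∑ i, f i) = m := by
  have h0' : lexOrder (f i₀) = (toLex (ofLex m) : Lex (σ →₀ ℕ)) := h0
  apply le_antisymm
  · apply lexOrder_le_of_coeff_ne_zero (d := ofLex m)
    rw [map_sum, Finset.sum_eq_single_of_mem i₀ (Finset.mem_univ _)]
    · exact coeff_ne_zero_of_lexOrder h0'.symm
    · exact fun i _ hi => coeff_eq_zero_of_lt_lexOrder (h i hi)
  · rw [le_lexOrder_iff]
    intro d hd
    rw [map_sum]
    refine Finset.sum_eq_zero fun i _ => coeff_eq_zero_of_lt_lexOrder (hd.trans_le ?_)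
    by_cases hi : i = i₀
    · rw [hi, h0]
    · exact (h i hi).le

lemma linearIndependent_of_lexOrder {ι : Type*} (f : ι → MvPowerSeries σ ℂ)
    (m : ι → Lex (σ →₀ ℕ)) (hf : ∀ i, lexOrder (f i) = m i) (hm : Function.Injective m) :
    LinearIndependent ℂ f := by
  classical
  rw [linearIndependent_iff']
  intro s c hc
  by_contra! hne
  obtain ⟨i₁, hi₁, hci₁⟩ := hne
  obtain ⟨i₀, hi₀, hmin⟩ := Finset.exists_min_image (s.filter fun i => c i ≠ 0) m
    ⟨i₁, by simp [hi₁, hci₁]⟩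
  simp only [Finset.mem_filter] at hi₀ hmin
  have := congrArg (coeff (ofLex (m i₀))) hc
  rw [map_sum, Finset.sum_eq_single_of_mem i₀ hi₀.1] at this
  · have h0' : lexOrder (f i₀) = (toLex (ofLex (m i₀)) : Lex (σ →₀ ℕ)) := hf i₀
    simp [hi₀.2] at this
    exact coeff_ne_zero_of_lexOrder h0'.symm this
  · intro i hi hne
    by_cases hci : c i = 0
    · simp [hci]
    · have : m i₀ < m i := lt_of_le_of_ne (hmin i ⟨hi, hci⟩) (fun h => hne (hm h.symm))
      have : coeff (ofLex (m i₀)) (f i) = 0 := by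
        apply coeff_eq_zero_of_lt_lexOrder
        rw [hf]
        exact WithTop.coe_lt_coe.2 this
      simp [this]

/-- The exponent contributed by an entry in position `(r, j)` of a matrix whose entries at
`(r, 2 * r)` are `1` and whose entries to the right of these are variables `X (q r j)`. -/
def rowExponent {n : ℕ} (q : Fin n → Fin (2 * n) → σ) (r : Fin n) (j : Fin (2 * n)) : σ →₀ ℕ :=
  if j.1 = 2 * r.1 then 0 else Finsupp.single (q r j) 1

lemma lexOrder_det_isotropic {n p : ℕ} (hp : p ≤ n) (q : Fin n → Fin (2 * n) → σ)
    (hq : ∀ r s j j', r < s → q r j < q s j') (hq' : ∀ r j j', j < j' → q r j' < q r j)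
    (N : Matrix (Fin n) (Fin (2 * n)) (MvPowerSeries σ ℂ))
    (hN : ∀ (r : Fin n) (j : Fin (2 * n)), j.1 = 2 * r.1 → N r j = 1)
    (hN' : ∀ (r : Fin n) (j : Fin (2 * n)), 2 * r.1 < j.1 → N r j = X (q r j))
    (J : Fin p → Fin (2 * n)) (hJ : StrictMono J) (hJ' : ∀ r, 2 * r.1 ≤ (J r).1) :
    lexOrder (N.submatrix (Fin.castLE hp) J).det =
      (toLex (∑ r, rowExponent q (Fin.castLE hp r) (J r)) : Lex (σ →₀ ℕ)) := by
  have hmain : ∀ r, lexOrder (N (Fin.castLE hp r) (J r)) =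
      (toLex (rowExponent q (Fin.castLE hp r) (J r)) : Lex (σ →₀ ℕ)) := by
    intro r
    unfold rowExponent
    split_ifs with h
    · rw [hN _ _ (by simpa using h), lexOrder_one_eq]; rfl
    · rw [hN' _ _ (by have := hJ' r; simp at h ⊢; omega), lexOrder_X_eq]
  have hsign : ∀ (τ : Equiv.Perm (Fin p)) (f : MvPowerSeries σ ℂ),
      lexOrder (Equiv.Perm.sign τ • f) = lexOrder f := by
    intro τ f
    rcases Int.units_eq_one_or (Equiv.Perm.sign τ) with h | h <;> simp [h, lexOrder_neg_eq]
  rw [← Matrix.det_transpose, Matrix.det_apply]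
  refine lexOrder_sum_eq _ 1 _ ?_ ?_
  · rw [hsign, lexOrder_prod, coe_toLex_sum]
    exact Finset.sum_congr rfl fun r _ => by simp [hmain]
  · intro τ hτ
    rw [hsign, lexOrder_prod]
    obtain ⟨r₀, hr₀, hmin⟩ : ∃ r₀, τ r₀ ≠ r₀ ∧ ∀ r < r₀, τ r = r := by
      have hne : (Finset.univ.filter fun r => τ r ≠ r).Nonempty := by
        by_contra h
        rw [Finset.not_nonempty_iff_eq_empty, Finset.filter_eq_empty_iff] at h
        exact hτ (Equiv.ext fun r => by simpa using h (Finset.mem_univ r))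
      refine ⟨Finset.min' _ hne, (Finset.mem_filter.1 (Finset.min'_mem _ hne)).2, fun r hr => ?_⟩
      by_contra h
      exact absurd (Finset.min'_le _ r (by simpa using h)) (not_le.2 hr)
    have hlt : r₀ < τ r₀ := by
      refine lt_of_le_of_ne (not_lt.1 fun h => ?_) hr₀.symm
      exact hr₀ (τ.injective (hmin _ h))
    refine toLex_sum_lt_sum _ _ (Finset.univ.filter fun r => r < r₀) (r₁ := r₀)
      (x := q (Fin.castLE hp r₀) (J (τ r₀))) ?_ (by simp) ?_ ?_
    · intro r hr
      have hr' := hmin r (by simpa using hr)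
      simp [Matrix.transpose_apply, hr', hmain]
    · have h1 := hJ' r₀
      have h2 : (J r₀).1 < (J (τ r₀)).1 := hJ hlt
      rw [Matrix.transpose_apply, Matrix.submatrix_apply, hN' _ _ (by simp; omega), lexOrder_X_eq]
    · intro r hr y hy
      have hr' : r₀ ≤ r := by simpa using hr
      unfold rowExponent at hy
      split_ifs at hy with h
      · simp at hy
      · obtain rfl : y = q (Fin.castLE hp r) (J r) := by
          have := Finsupp.support_single_subset hy
          simpa using this
        rcases hr'.eq_or_lt with rfl | hlt'
        · exact hq' _ _ _ (hJ hlt)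
        · exact hq _ _ _ _ (by simpa using hlt')

lemma det_mul_submatrix {R : Type*} [CommRing R] {ι κ m p : Type*} [Fintype m] [DecidableEq m]
    [Fintype p] [DecidableEq p] (A : Matrix ι m R) (N : Matrix m κ R) (I : p → ι) (J : p → κ) :
    ((A * N).submatrix I J).det =
      ∑ s : p → m, (∏ r, A (I r) (s r)) * (N.submatrix s J).det := by
  have h := (Matrix.detRowAlternating (R := R) (n := p)).toMultilinearMap.map_sum
    (fun (r : p) (s : m) => A (I r) s • fun c => N s (J c))
  have h2 : (fun r : p => ∑ s : m, A (I r) s • fun c => N s (J c)) =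
      ((A * N).submatrix I J) := by
    ext r c
    simp [Matrix.mul_apply]
  rw [h2] at h
  refine h.trans (Finset.sum_congr rfl fun s _ => ?_)
  rw [MultilinearMap.map_smul_univ]
  rfl

lemma exists_index_of_ne {n p : ℕ} (hp : p ≤ n) {s : Fin p → Fin n} (hs : Function.Injective s)
    (hne : s ≠ Fin.castLE hp) :
    ∃ r₀ r₁ : Fin p, r₁ ≤ r₀ ∧ (∀ r, r₀ < r → s r = Fin.castLE hp r) ∧
      (r₀.1 < (s r₁).1 ∨ (r₀.1 = (s r₁).1 ∧ r₁ < r₀)) := by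
  have hne' : (Finset.univ.filter fun r => s r ≠ Fin.castLE hp r).Nonempty := by
    by_contra h
    rw [Finset.not_nonempty_iff_eq_empty, Finset.filter_eq_empty_iff] at h
    exact hne (funext fun r => by simpa using h (Finset.mem_univ r))
  set r₀ := Finset.max' _ hne'
  have hr₀ : s r₀ ≠ Fin.castLE hp r₀ := (Finset.mem_filter.1 (Finset.max'_mem _ hne')).2
  refine ⟨r₀, ?_⟩
  by_contra! hcon
  have hmax : ∀ r, r₀ < r → s r = Fin.castLE hp r := by
    intro r hr
    by_contra h
    exact absurd (Finset.le_max' _ r (by simpa using h)) (not_le.2 hr)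
  have hmaps : Set.MapsTo s (Finset.univ.filter fun r : Fin p => r ≤ r₀)
      ((Finset.univ.filter fun r : Fin p => r < r₀).image (Fin.castLE hp)) := by
    intro r hr
    have hr' : r ≤ r₀ := by simpa using hr
    obtain ⟨h1, h2⟩ := hcon r hr' hmax
    have h3 : (s r).1 ≠ r₀.1 := by
      intro h
      rcases hr'.eq_or_lt with rfl | hlt
      · exact hr₀ (Fin.ext (by simpa using h))
      · exact absurd (h2 h.symm) (not_le.2 hlt)
    simp only [Finset.coe_image, Set.mem_image]
    exact ⟨⟨(s r).1, by omega⟩, Finset.mem_coe.2 (Finset.mem_filter.2 ⟨Finset.mem_univ _,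
      Fin.lt_def.2 (by simp only []; omega)⟩), rfl⟩
  have hcard := Finset.card_le_card_of_injOn s hmaps hs.injOn
  rw [Finset.card_image_of_injective _ (Fin.castLE_injective hp)] at hcard
  refine absurd hcard (not_le.2 (Finset.card_lt_card ?_))
  rw [Finset.ssubset_iff_of_subset]
  · exact ⟨r₀, by simp, by simp⟩
  · intro r hr
    simp at hr ⊢
    exact hr.le

lemma lexOrder_det_mul {k n p : ℕ} (hp : p ≤ n) (a : Fin n → Fin k → σ)
    (A : Matrix (Fin k) (Fin n) (MvPowerSeries σ ℂ)) (hA : ∀ i r, A i r = X (a r i))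
    (q : Fin n → Fin (2 * n) → σ) (ha : ∀ r s i i', r < s → a s i < a r i')
    (ha' : ∀ r i i', i < i' → a r i < a r i') (haq : ∀ r i s j, a r i < q s j)
    (hq : ∀ r s j j', r < s → q r j < q s j') (hq' : ∀ r j j', j < j' → q r j' < q r j)
    (N : Matrix (Fin n) (Fin (2 * n)) (MvPowerSeries σ ℂ))
    (hN : ∀ (r : Fin n) (j : Fin (2 * n)), j.1 = 2 * r.1 → N r j = 1)
    (hN' : ∀ (r : Fin n) (j : Fin (2 * n)), 2 * r.1 < j.1 → N r j = X (q r j))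
    (I : Fin p → Fin k) (hI : StrictMono I)
    (J : Fin p → Fin (2 * n)) (hJ : StrictMono J) (hJ' : ∀ r, 2 * r.1 ≤ (J r).1) :
    lexOrder ((A * N).submatrix I J).det =
      (toLex (∑ r, (Finsupp.single (a (Fin.castLE hp r) (I r)) 1 +
        rowExponent q (Fin.castLE hp r) (J r))) : Lex (σ →₀ ℕ)) := by
  classical
  rw [det_mul_submatrix]
  refine lexOrder_sum_eq _ (Fin.castLE hp) _ ?_ ?_
  · rw [lexOrder_mul, lexOrder_prod, lexOrder_det_isotropic hp q hq hq' N hN hN' J hJ hJ',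
      Finset.sum_add_distrib, toLex_add, WithTop.coe_add,
      coe_toLex_sum (fun r => Finsupp.single (a (Fin.castLE hp r) (I r)) 1)]
    congr 1
    exact Finset.sum_congr rfl fun r _ => by rw [hA, lexOrder_X_eq]
  · intro s hs
    by_cases hinj : Function.Injective s
    · obtain ⟨r₀, r₁, hr, hmax, hr₁⟩ := exists_index_of_ne hp hinj hs
      rw [lexOrder_mul, lexOrder_prod]
      refine lt_of_lt_of_le ?_ (le_add_of_nonneg_right bot_le)
      have key := toLex_sum_lt_sum (ι := Fin p ⊕ Fin p)
        (Sum.elim (fun r => Finsupp.single (a (Fin.castLE hp r) (I r)) 1)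
          (fun r => rowExponent q (Fin.castLE hp r) (J r)))
        (Sum.elim (fun r => lexOrder (X (a (s r) (I r)) : MvPowerSeries σ ℂ)) (fun _ => 0))
        ((Finset.univ.filter fun r => r₀ < r).map Function.Embedding.inl) (r₁ := Sum.inl r₁)
        (x := a (s r₁) (I r₁)) ?_ (by simpa using hr) ?_ ?_
      · simpa [Fintype.sum_sum_type, Finset.sum_add_distrib, hA] using key
      · intro t ht
        obtain ⟨r, hr, rfl⟩ := Finset.mem_map.1 ht
        simp [hmax r (by simpa using hr), lexOrder_X_eq]
      · simp [lexOrder_X_eq]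
      · rintro (r | r) hr y hy
        · have hr' : r ≤ r₀ := by simpa using hr
          obtain rfl : y = a (Fin.castLE hp r) (I r) := by
            have := Finsupp.support_single_subset hy
            simpa using this
          rcases hr₁ with hr₁ | ⟨hr₁, hlt⟩
          · exact ha _ _ _ _ (by rw [Fin.lt_def]; simp; omega)
          · rcases hr'.eq_or_lt with rfl | hlt'
            · have : s r₁ = Fin.castLE hp r := Fin.ext (by simpa using hr₁.symm)
              rw [this]
              exact ha' _ _ _ (hI hlt)
            · exact ha _ _ _ _ (by rw [Fin.lt_def]; simp; omega)
        · simp only [Sum.elim_inr, rowExponent] at hy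
          split_ifs at hy with h
          · simp at hy
          · obtain rfl : y = q (Fin.castLE hp r) (J r) := by
              have := Finsupp.support_single_subset hy
              simpa using this
            exact haq _ _ _ _
    · have : (N.submatrix s J).det = 0 := by
        rw [Function.Injective] at hinj
        push Not at hinj
        obtain ⟨r, r', h, hne⟩ := hinj
        exact Matrix.det_zero_of_row_eq hne (funext fun c => by simp [h])
      rw [this, mul_zero, lexOrder_zero]
      exact WithTop.coe_lt_top _

end LexOrder

section Chains

lemma tleq_trans {A B C : List ℕ × List ℕ} (h : tleq A B) (h' : tleq B C) : tleq A C :=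
  ⟨h'.1.trans h.1, fun r hr => ⟨(h.2 r (hr.trans_le h'.1)).1.trans (h'.2 r hr).1,
    (h.2 r (hr.trans_le h'.1)).2.trans (h'.2 r hr).2⟩⟩

instance : Trans tleq tleq tleq := ⟨tleq_trans⟩

lemma pairwise_filterMap_fst {L : List (List ℕ × List ℕ)} (h : L.Pairwise tleq) (r : ℕ) :
    (L.filterMap fun t => t.1[r]?).Pairwise (· ≤ ·) := by
  rw [List.pairwise_filterMap]
  refine h.imp fun {A B} hAB x hx y hy => ?_
  have hr : r < B.1.length := (List.getElem?_eq_some_iff.1 hy).1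
  simpa [List.getD_eq_getElem?_getD, hx, hy] using (hAB.2 r hr).1

lemma pairwise_filterMap_snd {L : List (List ℕ × List ℕ)} (h : L.Pairwise tleq)
    (hL : ∀ t ∈ L, t.1.length = t.2.length) (r : ℕ) :
    (L.filterMap fun t => t.2[r]?).Pairwise (· ≤ ·) := by
  rw [List.pairwise_filterMap]
  refine h.imp_of_mem fun {A B} hA hB hAB x hx y hy => ?_
  have hr : r < B.1.length := by
    rw [hL B hB]; exact (List.getElem?_eq_some_iff.1 hy).1
  simpa [List.getD_eq_getElem?_getD, hx, hy] using (hAB.2 r hr).2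

lemma head?_filterMap_getElem? {L : List (List ℕ)} (h : L.Pairwise fun A B => B.length ≤ A.length)
    (r : ℕ) : (L.filterMap fun t => t[r]?).head? = L.head?.bind fun t => t[r]? := by
  cases L with
  | nil => rfl
  | cons A L =>
    simp only [List.head?_cons, Option.bind_some]
    rcases hA : A[r]? with _ | x
    · have : (List.filterMap (fun t : List ℕ => t[r]?) (A :: L)) = [] := by
        rw [List.filterMap_eq_nil_iff]
        intro B hB
        rw [List.getElem?_eq_none_iff] at hA ⊢
        rcases List.mem_cons.1 hB with rfl | hB
        · exact hA
        · exact ((List.pairwise_cons.1 h).1 B hB).trans hA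
      rw [this]; rfl
    · rw [List.filterMap_cons_some (f := fun t : List ℕ => t[r]?) hA]; rfl

lemma eq_of_filterMap_getElem?_eq {L L' : List (List ℕ)}
    (h : L.Pairwise fun A B => B.length ≤ A.length)
    (h' : L'.Pairwise fun A B => B.length ≤ A.length) (hL : ∀ A ∈ L, A ≠ []) (hL' : ∀ A ∈ L', A ≠ [])
    (heq : ∀ r : ℕ, (L.filterMap fun t => t[r]?) = L'.filterMap fun t => t[r]?) : L = L' := by
  induction L generalizing L' with
  | nil =>
    cases L' with
    | nil => rfl
    | cons B L' =>
      have h1 := congrArg List.head? (heq 0)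
      rw [head?_filterMap_getElem? h', head?_filterMap_getElem? h] at h1
      simp at h1
      exact absurd h1 (hL' B (by simp))
  | cons A L ih =>
    have h1 := fun r => congrArg List.head? (heq r)
    simp_rw [head?_filterMap_getElem? h', head?_filterMap_getElem? h] at h1
    cases L' with
    | nil =>
      have := h1 0
      simp at this
      exact absurd this (hL A (by simp))
    | cons B L' =>
      obtain rfl : A = B := List.ext_getElem? (by simpa using h1)
      rw [ih (List.pairwise_cons.1 h).2 (List.pairwise_cons.1 h').2
        (fun A hA => hL A (List.mem_cons_of_mem _ hA))
        (fun A hA => hL' A (List.mem_cons_of_mem _ hA))]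
      intro r
      have h2 := heq r
      rcases hA : A[r]? with _ | x
      · rwa [List.filterMap_cons_none (f := fun t : List ℕ => t[r]?) hA,
          List.filterMap_cons_none (f := fun t : List ℕ => t[r]?) hA] at h2
      · rw [List.filterMap_cons_some (f := fun t : List ℕ => t[r]?) hA,
          List.filterMap_cons_some (f := fun t : List ℕ => t[r]?) hA] at h2
        exact (List.cons.inj h2).2

lemma perm_of_count_eq_of_ne {l l' : List ℕ} (j : ℕ) (hlen : l.length = l'.length)
    (h : ∀ i ≠ j, l.count i = l'.count i) : l.Perm l' := by
  have h1 : (l.filter fun i => i ≠ j).Perm (l'.filter fun i => i ≠ j) := by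
    rw [List.perm_iff_count]
    intro i
    by_cases hi : i = j
    · rw [List.count_eq_zero_of_not_mem, List.count_eq_zero_of_not_mem] <;> simp [hi]
    · rw [List.count_filter (by simpa using hi), List.count_filter (by simpa using hi), h i hi]
  rw [List.perm_iff_count]
  intro i
  by_cases hi : i = j
  · have h2 := l.length_eq_countP_add_countP (fun i => i == j)
    have h3 := l'.length_eq_countP_add_countP (fun i => i == j)
    have h4 := h1.length_eq
    rw [← List.countP_eq_length_filter, ← List.countP_eq_length_filter] at h4
    simp only [beq_iff_eq, ne_eq] at h2 h3 h4
    rw [hi, List.count_eq_countP, List.count_eq_countP]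
    omega
  · exact h i hi

end Chains

section Independence

open MvPowerSeries

lemma exists_orderedVariables (k n : ℕ) :
    ∃ (σ : Type) (_ : LinearOrder σ) (_ : WellFoundedGT σ) (a : Fin n → Fin k → σ)
      (q : Fin n → Fin (2 * n) → σ), (∀ r s i i', r < s → a s i < a r i') ∧
      (∀ r i i', i < i' → a r i < a r i') ∧ (∀ r i s j, a r i < q s j) ∧
      (∀ r s j j', r < s → q r j < q s j') ∧ (∀ r j j', j < j' → q r j' < q r j) := by
  refine ⟨((Fin n)ᵒᵈ ×ₗ Fin k) ⊕ₗ (Fin n ×ₗ (Fin (2 * n))ᵒᵈ), inferInstance, inferInstance,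
    fun r i => Sum.inlₗ (toLex (OrderDual.toDual r, i)),
    fun r j => Sum.inrₗ (toLex (r, OrderDual.toDual j)), ?_, ?_, ?_, ?_, ?_⟩
  · intro r s i i' h
    exact Sum.Lex.inl_lt_inl_iff.2 (Prod.Lex.toLex_lt_toLex.2 (Or.inl (by simpa using h)))
  · intro r i i' h
    exact Sum.Lex.inl_lt_inl_iff.2 (Prod.Lex.toLex_lt_toLex.2 (Or.inr ⟨rfl, h⟩))
  · intro r i s j
    exact Sum.Lex.inl_lt_inr _ _
  · intro r s j j' h
    exact Sum.Lex.inr_lt_inr_iff.2 (Prod.Lex.toLex_lt_toLex.2 (Or.inl h))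
  · intro r j j' h
    exact Sum.Lex.inr_lt_inr_iff.2 (Prod.Lex.toLex_lt_toLex.2 (Or.inr ⟨rfl, by simpa using h⟩))

variable {σ : Type*} [LinearOrder σ] [WellFoundedGT σ]

lemma exists_lexOrder_dmin {k n : ℕ} (a : Fin n → Fin k → σ)
    (q : Fin n → Fin (2 * n) → σ) (ha : ∀ r s i i', r < s → a s i < a r i')
    (ha' : ∀ r i i', i < i' → a r i < a r i') (haq : ∀ r i s j, a r i < q s j)
    (hq : ∀ r s j j', r < s → q r j < q s j') (hq' : ∀ r j j', j < j' → q r j' < q r j)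
    (A : Matrix (Fin k) (Fin n) (MvPowerSeries σ ℂ)) (hA : ∀ i r, A i r = X (a r i))
    (N : Matrix (Fin n) (Fin (2 * n)) (MvPowerSeries σ ℂ))
    (hN : ∀ (r : Fin n) (j : Fin (2 * n)), j.1 = 2 * r.1 → N r j = 1)
    (hN' : ∀ (r : Fin n) (j : Fin (2 * n)), 2 * r.1 < j.1 → N r j = X (q r j))
    (t : List ℕ × List ℕ) (ht : isTabN k n t.1 t.2) :
    ∃ m : σ →₀ ℕ, lexOrder (MvPolynomial.aeval (fun ij : Fin k × Fin (2 * n) => (A * N) ij.1 ij.2)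
        (dmin k (2 * n) t.1 t.2)) = (toLex m : Lex (σ →₀ ℕ)) ∧
      (∀ r i, m (a r i) = if t.1[r.1]? = some (i.1 + 1) then 1 else 0) ∧
      (∀ r j, j.1 ≠ 2 * r.1 → m (q r j) = if t.2[r.1]? = some (j.1 + 1) then 1 else 0) := by
  classical
  obtain ⟨I, J⟩ := t
  obtain ⟨⟨hlen, -, hI, hJ, hIk, hJn⟩, hlen', -, hJt⟩ := ht
  simp only at *
  have hp : I.length ≤ n := hlen'.trans (min_le_right _ _)
  have hIP : I.Pairwise (· < ·) := List.isChain_iff_pairwise.1 hI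
  have hJP : J.Pairwise (· < ·) := List.isChain_iff_pairwise.1 hJ
  have hIr : ∀ r : Fin I.length, I.getD r 0 = I[r] := fun r => by simp
  have hJr : ∀ r : Fin I.length, J.getD r 0 = J[r.1]'(hlen ▸ r.2) := fun r => by
    simp [show r.1 < J.length by omega]
  have hIb : ∀ r : Fin I.length, 1 ≤ I.getD r 0 ∧ I.getD r 0 ≤ k := fun r => by
    rw [hIr]; exact hIk _ (List.getElem_mem _)
  have hJb : ∀ r : Fin I.length, 1 ≤ J.getD r 0 ∧ J.getD r 0 ≤ 2 * n := fun r => by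
    rw [hJr]; exact hJn _ (List.getElem_mem _)
  let I' : Fin I.length → Fin k := fun r => ⟨I.getD r 0 - 1, by have := hIb r; omega⟩
  let J' : Fin I.length → Fin (2 * n) := fun r => ⟨J.getD r 0 - 1, by have := hJb r; omega⟩
  have hI' : StrictMono I' := fun r s hrs => by
    have h1 := hIb r
    have h2 : I.getD r 0 < I.getD s 0 := by
      rw [hIr, hIr]; exact List.pairwise_iff_getElem.1 hIP _ _ _ _ hrs
    rw [Fin.lt_def]
    simp only [I']
    omega
  have hJ' : StrictMono J' := fun r s hrs => by
    have h1 := hJb r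
    have h2 : J.getD r 0 < J.getD s 0 := by
      rw [hJr, hJr]; exact List.pairwise_iff_getElem.1 hJP _ _ _ _ hrs
    rw [Fin.lt_def]
    simp only [J']
    omega
  have hJ'' : ∀ r, 2 * r.1 ≤ (J' r).1 := fun r => by
    have := hJt r (by omega)
    simp only [J']
    omega
  have hainj : ∀ r s i i', a r i = a s i' ↔ r = s ∧ i = i' := by
    refine fun r s i i' => ⟨fun h => ?_, by rintro ⟨rfl, rfl⟩; rfl⟩
    rcases lt_trichotomy r s with h1 | rfl | h1
    · exact absurd h (ha r s i' i h1).ne'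
    · refine ⟨rfl, ?_⟩
      rcases lt_trichotomy i i' with h2 | h2 | h2
      · exact absurd h (ha' r i i' h2).ne
      · exact h2
      · exact absurd h (ha' r i' i h2).ne'
    · exact absurd h (ha s r i i' h1).ne
  have hqinj : ∀ r s i i', q r i = q s i' ↔ r = s ∧ i = i' := by
    refine fun r s i i' => ⟨fun h => ?_, by rintro ⟨rfl, rfl⟩; rfl⟩
    rcases lt_trichotomy r s with h1 | rfl | h1
    · exact absurd h (hq r s i i' h1).ne
    · refine ⟨rfl, ?_⟩
      rcases lt_trichotomy i i' with h2 | h2 | h2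
      · exact absurd h (hq' r i i' h2).ne'
      · exact h2
      · exact absurd h (hq' r i' i h2).ne
    · exact absurd h (hq s r i' i h1).ne'
  refine ⟨∑ r, (Finsupp.single (a (Fin.castLE hp r) (I' r)) 1 +
        rowExponent q (Fin.castLE hp r) (J' r)), ?_, ?_, ?_⟩
  · rw [← lexOrder_det_mul hp a A hA q ha ha' haq hq hq' N hN hN' I' hI' J' hJ' hJ'']
    congr 1
    unfold dmin
    rw [AlgHom.map_det]
    congr 1
    ext1 r c
    have h1 := hIb r
    have h2 := hJb c
    rw [AlgHom.mapMatrix_apply, Matrix.map_apply, Matrix.of_apply, dif_pos ⟨by omega, by omega⟩,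
      MvPolynomial.aeval_X]
    rfl
  · intro r i
    have hterm : ∀ s : Fin I.length, (Finsupp.single (a (Fin.castLE hp s) (I' s)) 1 +
        rowExponent q (Fin.castLE hp s) (J' s) : σ →₀ ℕ) (a r i) =
          if Fin.castLE hp s = r ∧ I' s = i then 1 else 0 := by
      intro s
      have h2 : rowExponent q (Fin.castLE hp s) (J' s) (a r i) = 0 := by
        unfold rowExponent
        split_ifs
        · rfl
        · rw [Finsupp.single_eq_of_ne (haq _ _ _ _).ne]
      rw [Finsupp.add_apply, h2, add_zero, Finsupp.single_apply]
      simp only [hainj]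
    rw [Finsupp.finsetSum_apply, Finset.sum_congr rfl fun s _ => hterm s]
    by_cases hr : r.1 < I.length
    · rw [Finset.sum_eq_single_of_mem ⟨r.1, hr⟩ (Finset.mem_univ _)]
      · have h1 := hIb ⟨r.1, hr⟩
        have h3 := hIr ⟨r.1, hr⟩
        simp only [Fin.getElem_fin] at h3
        have h4 : Fin.castLE hp ⟨r.1, hr⟩ = r := rfl
        rw [List.getElem?_eq_getElem hr, ← h3]
        simp only [h4, true_and, I', Fin.ext_iff, Option.some.injEq]
        refine if_congr ?_ rfl rfl
        simp only at h1
        omega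
      · intro s _ hs
        rw [if_neg]
        rintro ⟨rfl, -⟩
        exact hs rfl
    · rw [List.getElem?_eq_none (by omega), if_neg (by simp)]
      refine Finset.sum_eq_zero fun s _ => if_neg ?_
      rintro ⟨rfl, -⟩
      exact hr s.2
  · intro r j hj
    have hterm : ∀ s : Fin I.length, (Finsupp.single (a (Fin.castLE hp s) (I' s)) 1 +
        rowExponent q (Fin.castLE hp s) (J' s) : σ →₀ ℕ) (q r j) =
          if Fin.castLE hp s = r ∧ J' s = j then 1 else 0 := by
      intro s
      rw [Finsupp.add_apply, Finsupp.single_eq_of_ne (haq _ _ _ _).ne', zero_add]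
      unfold rowExponent
      split_ifs with h1 h2 h2
      · obtain ⟨rfl, rfl⟩ := h2
        exact absurd h1 hj
      · rfl
      · obtain ⟨rfl, rfl⟩ := h2
        simp
      · rw [Finsupp.single_eq_of_ne]
        rw [Ne, hqinj]
        rintro ⟨rfl, rfl⟩
        exact h2 ⟨rfl, rfl⟩
    rw [Finsupp.finsetSum_apply, Finset.sum_congr rfl fun s _ => hterm s]
    by_cases hr : r.1 < I.length
    · rw [Finset.sum_eq_single_of_mem ⟨r.1, hr⟩ (Finset.mem_univ _)]
      · have h1 := hJb ⟨r.1, hr⟩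
        have h3 := hJr ⟨r.1, hr⟩
        have h4 : Fin.castLE hp ⟨r.1, hr⟩ = r := rfl
        rw [List.getElem?_eq_getElem (hlen ▸ hr), ← h3]
        simp only [h4, true_and, J', Fin.ext_iff, Option.some.injEq]
        refine if_congr ?_ rfl rfl
        simp only at h1
        omega
      · intro s _ hs
        rw [if_neg]
        rintro ⟨rfl, -⟩
        exact hs rfl
    · rw [List.getElem?_eq_none (by omega), if_neg (by simp)]
      refine Finset.sum_eq_zero fun s _ => if_neg ?_
      rintro ⟨rfl, -⟩
      exact hr s.2

lemma lexOrder_list_prod {ι : Type*} (L : List ι) (f : ι → MvPowerSeries σ ℂ) (m : ι → σ →₀ ℕ)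
    (h : ∀ t ∈ L, lexOrder (f t) = (toLex (m t) : Lex (σ →₀ ℕ))) :
    lexOrder (L.map f).prod = (toLex (L.map m).sum : Lex (σ →₀ ℕ)) := by
  induction L with
  | nil => simpa using lexOrder_one_eq
  | cons t L ih =>
    rw [List.map_cons, List.prod_cons, lexOrder_mul, h t (by simp),
      ih fun t ht => h t (List.mem_cons_of_mem _ ht)]
    rfl

lemma sum_map_apply_eq_count {τ ι : Type*} (L : List ι) (m : ι → τ →₀ ℕ) (x : τ)
    (g : ι → Option ℕ) (i : ℕ) (h : ∀ t ∈ L, m t x = if g t = some i then 1 else 0) :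
    (L.map m).sum x = (L.filterMap g).count i := by
  induction L with
  | nil => simp
  | cons t L ih =>
    rw [List.map_cons, List.sum_cons, Finsupp.add_apply, h t (by simp),
      ih fun t ht => h t (List.mem_cons_of_mem _ ht)]
    rcases hg : g t with _ | x
    · simp [List.filterMap_cons_none hg]
    · rw [List.filterMap_cons_some hg, List.count_cons]
      simp [add_comm]

lemma eq_of_sum_map_eq {τ : Type*} {k n : ℕ} (a : Fin n → Fin k → τ) (q : Fin n → Fin (2 * n) → τ)
    (m : List ℕ × List ℕ → τ →₀ ℕ)
    (hma : ∀ t, isTabN k n t.1 t.2 → ∀ r i, m t (a r i) =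
      if t.1[r.1]? = some (i.1 + 1) then 1 else 0)
    (hmq : ∀ t, isTabN k n t.1 t.2 → ∀ r j, j.1 ≠ 2 * r.1 → m t (q r j) =
      if t.2[r.1]? = some (j.1 + 1) then 1 else 0)
    {L L' : List (List ℕ × List ℕ)} (hL : ∀ t ∈ L, isTabN k n t.1 t.2)
    (hL' : ∀ t ∈ L', isTabN k n t.1 t.2) (hc : L.Pairwise tleq) (hc' : L'.Pairwise tleq)
    (h : (L.map m).sum = (L'.map m).sum) : L = L' := by
  have hlen : ∀ t : List ℕ × List ℕ, isTabN k n t.1 t.2 → t.1.length = t.2.length :=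
    fun t ht => ht.1.1
  have hnil : ∀ t : List ℕ × List ℕ, isTabN k n t.1 t.2 → t.1 ≠ [] ∧ t.2 ≠ [] := by
    refine fun t ht => ⟨ht.1.2.1, fun h => ht.1.2.1 ?_⟩
    rw [← List.length_eq_zero_iff, hlen t ht, h]; rfl
  have hI : ∀ r : ℕ, (L.filterMap fun t => t.1[r]?) = L'.filterMap fun t => t.1[r]? := by
    intro r
    refine List.Perm.eq_of_pairwise (le := (· ≤ ·)) (fun _ _ _ _ h h' => le_antisymm h h')
      (pairwise_filterMap_fst hc r) (pairwise_filterMap_fst hc' r) ?_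
    rw [List.perm_iff_count]
    intro i
    by_cases hri : r < n ∧ 1 ≤ i ∧ i ≤ k
    · have e := DFunLike.congr_fun h (a ⟨r, hri.1⟩ ⟨i - 1, by omega⟩)
      rwa [sum_map_apply_eq_count L m _ (fun t => t.1[r]?) i,
        sum_map_apply_eq_count L' m _ (fun t => t.1[r]?) i] at e
      · intro t ht
        rw [hma t (hL' t ht), show i - 1 + 1 = i by omega]
      · intro t ht
        rw [hma t (hL t ht), show i - 1 + 1 = i by omega]
    · have key : ∀ L : List (List ℕ × List ℕ), (∀ t ∈ L, isTabN k n t.1 t.2) →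
          (L.filterMap fun t => t.1[r]?).count i = 0 := by
        intro L hL
        rw [List.count_eq_zero, List.mem_filterMap]
        rintro ⟨t, ht, h⟩
        obtain ⟨h1, h2⟩ := List.getElem?_eq_some_iff.1 h
        obtain ⟨⟨-, -, -, -, h3, -⟩, h4, -⟩ := hL t ht
        have h5 := h3 i (h2 ▸ List.getElem_mem h1)
        exact hri ⟨by have := h4.trans (min_le_right _ _); omega, h5⟩
      rw [key L hL, key L' hL']
  have hfst : L.map Prod.fst = L'.map Prod.fst := by
    refine eq_of_filterMap_getElem?_eq ?_ ?_ ?_ ?_ ?_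
    · exact List.pairwise_map.2 (hc.imp fun h => h.1)
    · exact List.pairwise_map.2 (hc'.imp fun h => h.1)
    · simpa using fun A x hx => (hnil _ (hL _ hx)).1
    · simpa using fun A x hx => (hnil _ (hL' _ hx)).1
    · intro r
      rw [List.filterMap_map, List.filterMap_map]
      exact hI r
  have hJ : ∀ r : ℕ, (L.filterMap fun t => t.2[r]?) = L'.filterMap fun t => t.2[r]? := by
    intro r
    refine List.Perm.eq_of_pairwise (le := (· ≤ ·)) (fun _ _ _ _ h h' => le_antisymm h h')
      (pairwise_filterMap_snd hc (fun t ht => hlen t (hL t ht)) r)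
      (pairwise_filterMap_snd hc' (fun t ht => hlen t (hL' t ht)) r) ?_
    refine perm_of_count_eq_of_ne (2 * r + 1) ?_ ?_
    · have key : ∀ L : List (List ℕ × List ℕ), (∀ t ∈ L, isTabN k n t.1 t.2) →
          (L.filterMap fun t => t.2[r]?).length = (L.filterMap fun t => t.1[r]?).length := by
        intro L hL
        rw [List.length_filterMap_eq_countP, List.length_filterMap_eq_countP]
        refine List.countP_congr fun t ht => ?_
        simp [hlen t (hL t ht)]
      rw [key L hL, key L' hL', hI]
    · intro i hir
      by_cases hri : r < n ∧ 1 ≤ i ∧ i ≤ 2 * n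
      · have e := DFunLike.congr_fun h (q ⟨r, hri.1⟩ ⟨i - 1, by omega⟩)
        rwa [sum_map_apply_eq_count L m _ (fun t => t.2[r]?) i,
          sum_map_apply_eq_count L' m _ (fun t => t.2[r]?) i] at e
        · intro t ht
          rw [hmq t (hL' t ht) _ _ (by simp only; omega), show i - 1 + 1 = i by omega]
        · intro t ht
          rw [hmq t (hL t ht) _ _ (by simp only; omega), show i - 1 + 1 = i by omega]
      · have key : ∀ L : List (List ℕ × List ℕ), (∀ t ∈ L, isTabN k n t.1 t.2) →
            (L.filterMap fun t => t.2[r]?).count i = 0 := by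
          intro L hL
          rw [List.count_eq_zero, List.mem_filterMap]
          rintro ⟨t, ht, h⟩
          obtain ⟨h1, h2⟩ := List.getElem?_eq_some_iff.1 h
          obtain ⟨⟨-, -, -, -, -, h3⟩, -, h4, -⟩ := hL t ht
          have h5 := h3 i (h2 ▸ List.getElem_mem h1)
          exact hri ⟨by omega, h5⟩
        rw [key L hL, key L' hL']
  have hsnd : L.map Prod.snd = L'.map Prod.snd := by
    refine eq_of_filterMap_getElem?_eq ?_ ?_ ?_ ?_ ?_
    · refine List.pairwise_map.2 (hc.imp_of_mem fun hA hB h => ?_)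
      rw [← hlen _ (hL _ hA), ← hlen _ (hL _ hB)]; exact h.1
    · refine List.pairwise_map.2 (hc'.imp_of_mem fun hA hB h => ?_)
      rw [← hlen _ (hL' _ hA), ← hlen _ (hL' _ hB)]; exact h.1
    · simpa using fun A x hx => (hnil _ (hL _ hx)).2
    · simpa using fun A x hx => (hnil _ (hL' _ hx)).2
    · intro r
      rw [List.filterMap_map, List.filterMap_map]
      exact hJ r
  rw [← List.zip_unzip L, ← List.zip_unzip L', List.unzip_eq_map, List.unzip_eq_map, hfst, hsnd]

lemma sum_mul_sum_sub {S ι : Type*} [CommRing S] [Fintype ι] (a b x y : ι → S) :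
    (∑ r, a r * x r) * (∑ s, b s * y s) - (∑ s, b s * x s) * (∑ r, a r * y r) =
      ∑ r, ∑ s, a r * b s * (x r * y s - x s * y r) := by
  rw [mul_comm (∑ s, b s * x s), Finset.sum_mul_sum, Finset.sum_mul_sum, ← Finset.sum_sub_distrib]
  refine Finset.sum_congr rfl fun r _ => ?_
  rw [← Finset.sum_sub_distrib]
  exact Finset.sum_congr rfl fun s _ => by ring

lemma aeval_mul_rbase {k n : ℕ} {S : Type*} [CommRing S] [Algebra ℂ S]
    (A : Matrix (Fin k) (Fin n) S) (N : ℕ → ℕ → S)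
    (hN : ∀ r < n, ∀ s < n, sympPairing n (N r) (N s) = 0) (i j : Fin k) :
    MvPolynomial.aeval (fun ij : Fin k × Fin (2 * n) =>
      (A * Matrix.of fun (r : Fin n) (c : Fin (2 * n)) => N r c) ij.1 ij.2) (rbase k n i j) = 0 := by
  have : ∑ r : Fin n, ∑ s : Fin n, A i r * A j s * sympPairing n (N r) (N s) = 0 :=
    Finset.sum_eq_zero fun r _ => Finset.sum_eq_zero fun s _ => by
      rw [hN r r.2 s s.2, mul_zero]
  rw [← this]
  unfold rbase sympPairing
  simp only [map_sum, map_sub, map_mul, MvPolynomial.aeval_X, Matrix.mul_apply, Matrix.of_apply,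
    sum_mul_sum_sub, Finset.sum_range]
  simp only [Finset.mul_sum]
  rw [Finset.sum_comm]
  exact Finset.sum_congr rfl fun r _ => Finset.sum_comm

end Independence

/-- The standard monomials are linearly independent modulo the symplectic ideal. -/
theorem linearIndependent_standardMonomials (k n : ℕ) :
    LinearIndependent ℂ
      (fun L : {L : List (List ℕ × List ℕ) //
          (∀ t ∈ L, isTabN k n t.1 t.2) ∧ L.Chain' tleq} =>
        Ideal.Quotient.mk (sympIdeal k n)
          (((L : List (List ℕ × List ℕ)).map fun t => dmin k (2 * n) t.1 t.2).prod)) := by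
  obtain ⟨σ, _, _, a, q, ha, ha', haq, hq, hq'⟩ := exists_orderedVariables k n
  obtain ⟨N, hN1, hN2, hN3⟩ := exists_isotropic (S := MvPowerSeries σ ℂ) n fun r j =>
    if h : r < n ∧ j < 2 * n then MvPowerSeries.X (q ⟨r, h.1⟩ ⟨j, h.2⟩) else 0
  let A : Matrix (Fin k) (Fin n) (MvPowerSeries σ ℂ) := fun i r => MvPowerSeries.X (a r i)
  let N' : Matrix (Fin n) (Fin (2 * n)) (MvPowerSeries σ ℂ) := Matrix.of fun r c => N r c
  let φ : MvPolynomial (Fin k × Fin (2 * n)) ℂ →ₐ[ℂ] MvPowerSeries σ ℂ :=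
    MvPolynomial.aeval fun ij => (A * N') ij.1 ij.2
  have hφ : ∀ f ∈ sympIdeal k n, φ f = 0 := by
    intro f hf
    refine (Ideal.span_le (I := RingHom.ker φ)).2 ?_ hf
    rintro _ ⟨i, j, -, rfl⟩
    exact aeval_mul_rbase A N hN3 i j
  choose! m hm hma hmq using fun t ht => exists_lexOrder_dmin a q ha ha' haq hq hq' A
    (fun _ _ => rfl) N' (fun r j h => by simpa [N', h] using hN1 r r.2)
    (fun r j h => by simpa [N'] using hN2 r r.2 j h) t ht
  refine LinearIndependent.of_comp (Ideal.Quotient.liftₐ (sympIdeal k n) φ hφ).toLinearMap ?_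
  refine linearIndependent_of_lexOrder _ (fun L => toLex (L.1.map m).sum) ?_ ?_
  · intro L
    simp only [Function.comp_apply, AlgHom.toLinearMap_apply]
    rw [show (Ideal.Quotient.liftₐ (sympIdeal k n) φ hφ) (Ideal.Quotient.mk (sympIdeal k n)
      ((L.1.map fun t => dmin k (2 * n) t.1 t.2).prod)) =
        φ ((L.1.map fun t => dmin k (2 * n) t.1 t.2).prod) from rfl, map_list_prod, List.map_map]
    exact lexOrder_list_prod _ _ _ fun t ht => hm t (L.2.1 t ht)
  · intro L L' h
    exact Subtype.ext (eq_of_sum_map_eq a q m hma hmq L.2.1 L'.2.1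
      (List.isChain_iff_pairwise.1 L.2.2) (List.isChain_iff_pairwise.1 L'.2.2) (toLex.injective h))

section Bracket

variable {R K M : Type*} [CommRing R] [Fintype K] [DecidableEq K]

/-- The maximal minor of `Y` with columns `c`. -/
def bracket (Y : Matrix K M R) (c : K → M) : R := (Y.submatrix id c).det

lemma bracket_apply (Y : Matrix K M R) (c : K → M) :
    bracket Y c = ∑ τ : Equiv.Perm K, ((Equiv.Perm.sign τ : ℤ) : R) * ∏ r, Y (τ r) (c r) := by
  rw [bracket, Matrix.det_apply']
  rfl

lemma bracket_comp_perm (Y : Matrix K M R) (c : K → M) (π : Equiv.Perm K) :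
    bracket Y (c ∘ π) = ((Equiv.Perm.sign π : ℤ) : R) * bracket Y c := by
  rw [bracket, bracket, ← Matrix.det_permute']
  rfl

lemma bracket_eq_zero_of_not_injective (Y : Matrix K M R) {c : K → M}
    (hc : ¬ Function.Injective c) : bracket Y c = 0 := by
  rw [Function.Injective] at hc
  push Not at hc
  obtain ⟨r, s, h, hrs⟩ := hc
  exact Matrix.det_zero_of_column_eq hrs fun i => by simp [h]

lemma sum_perm_bracket_mul_bracket (Y : Matrix K M R) (w : K ⊕ K → M) (T : Finset (K ⊕ K))
    (hT : Fintype.card K < T.card) :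
    ∑ σ : Equiv.Perm T, ((Equiv.Perm.sign σ : ℤ) : R) *
      (bracket Y (w ∘ Equiv.Perm.ofSubtype σ ∘ Sum.inl) *
        bracket Y (w ∘ Equiv.Perm.ofSubtype σ ∘ Sum.inr)) = 0 := by
  have key : ∀ τ₁ τ₂ : Equiv.Perm K, ∑ σ : Equiv.Perm T, ((Equiv.Perm.sign σ : ℤ) : R) *
      ((∏ r, Y (τ₁ r) (w (Equiv.Perm.ofSubtype σ (Sum.inl r)))) *
        ∏ r, Y (τ₂ r) (w (Equiv.Perm.ofSubtype σ (Sum.inr r)))) = 0 := by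
    intro τ₁ τ₂
    set τ : K ⊕ K → K := Sum.elim τ₁ τ₂
    obtain ⟨a, b, hab, h⟩ := Fintype.exists_ne_map_eq_of_card_lt (fun p : T => τ p) (by simpa)
    have hdet : (Matrix.of fun p q : T => Y (τ q) (w p)).det = 0 :=
      Matrix.det_zero_of_column_eq hab fun p => by simp only [Matrix.of_apply, h]
    rw [Matrix.det_apply'] at hdet
    rw [← mul_zero (∏ p ∈ Tᶜ, Y (τ p) (w p)), ← hdet, Finset.mul_sum]
    refine Finset.sum_congr rfl fun σ _ => ?_
    have h1 : (∏ r, Y (τ₁ r) (w (Equiv.Perm.ofSubtype σ (Sum.inl r)))) *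
        ∏ r, Y (τ₂ r) (w (Equiv.Perm.ofSubtype σ (Sum.inr r))) =
          ∏ p : K ⊕ K, Y (τ p) (w (Equiv.Perm.ofSubtype σ p)) := by
      rw [Fintype.prod_sum_type]; rfl
    rw [h1, ← Finset.prod_mul_prod_compl T, ← Finset.prod_coe_sort T]
    have h2 : ∏ p ∈ Tᶜ, Y (τ p) (w (Equiv.Perm.ofSubtype σ p)) = ∏ p ∈ Tᶜ, Y (τ p) (w p) :=
      Finset.prod_congr rfl fun p hp => by
        rw [Equiv.Perm.ofSubtype_apply_of_not_mem σ (Finset.mem_compl.1 hp)]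
    rw [h2]
    simp only [Equiv.Perm.ofSubtype_apply_coe, Matrix.of_apply]
    ring
  simp_rw [bracket_apply, Finset.sum_mul_sum, Finset.mul_sum]
  rw [Finset.sum_comm]
  refine Finset.sum_eq_zero fun τ₁ _ => ?_
  rw [Finset.sum_comm]
  refine Finset.sum_eq_zero fun τ₂ _ => ?_
  rw [← mul_zero (((Equiv.Perm.sign τ₁ : ℤ) : R) * ((Equiv.Perm.sign τ₂ : ℤ) : R)), ← key τ₁ τ₂,
    Finset.mul_sum]
  refine Finset.sum_congr rfl fun σ _ => ?_
  simp only [Function.comp_apply]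
  ring

lemma sign_mul_bracket_mul_bracket (Y : Matrix K M R) (w : K ⊕ K → M) (σ : Equiv.Perm (K ⊕ K))
    (hσ : Set.MapsTo σ (Set.range Sum.inl) (Set.range Sum.inl)) :
    ((Equiv.Perm.sign σ : ℤ) : R) * (bracket Y (w ∘ σ ∘ Sum.inl) * bracket Y (w ∘ σ ∘ Sum.inr)) =
      bracket Y (w ∘ Sum.inl) * bracket Y (w ∘ Sum.inr) := by
  obtain ⟨⟨σ₁, σ₂⟩, rfl⟩ := Equiv.Perm.mem_sumCongrHom_range_of_perm_mapsTo_inl hσ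
  have h1 : w ∘ (Equiv.Perm.sumCongrHom K K (σ₁, σ₂)) ∘ Sum.inl = (w ∘ Sum.inl) ∘ σ₁ := rfl
  have h2 : w ∘ (Equiv.Perm.sumCongrHom K K (σ₁, σ₂)) ∘ Sum.inr = (w ∘ Sum.inr) ∘ σ₂ := rfl
  have h3 : ∀ u : ℤˣ, ((u : ℤ) : R) * ((u : ℤ) : R) = 1 := fun u => by
    rw [← Int.cast_mul, ← Units.val_mul, Int.units_mul_self]; simp
  rw [h1, h2, bracket_comp_perm, bracket_comp_perm, Equiv.Perm.sumCongrHom_apply,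
    Equiv.Perm.sign_sumCongr]
  push_cast
  linear_combination (((Equiv.Perm.sign σ₂ : ℤ) : R) * ((Equiv.Perm.sign σ₂ : ℤ) : R) *
    bracket Y (w ∘ Sum.inl) * bracket Y (w ∘ Sum.inr)) * h3 (Equiv.Perm.sign σ₁) +
    bracket Y (w ∘ Sum.inl) * bracket Y (w ∘ Sum.inr) * h3 (Equiv.Perm.sign σ₂)

end Bracket

section Weight

variable {K : Type*} [Fintype K]

/-- The weight of a column selection. -/
def weight (c : K → ℕ) : ℕ := ∑ r, 2 ^ c r

lemma weight_comp_add (w : K ⊕ K → ℕ) (σ : Equiv.Perm (K ⊕ K)) :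
    weight (w ∘ σ ∘ Sum.inl) + weight (w ∘ σ ∘ Sum.inr) =
      weight (w ∘ Sum.inl) + weight (w ∘ Sum.inr) := by
  have h := fun f : K ⊕ K → ℕ => Fintype.sum_sum_type (fun p => 2 ^ f p)
  exact (h (w ∘ σ)).symm.trans ((Equiv.sum_comp σ fun p => 2 ^ w p).trans (h w))

variable [DecidableEq K]

lemma weight_comp_lt (w : K ⊕ K → ℕ) (t : ℕ) (σ : Equiv.Perm (K ⊕ K))
    (hl : ∀ r, σ (Sum.inl r) ≠ Sum.inl r → t ≤ w (Sum.inl r))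
    (hr : ∀ r, σ (Sum.inr r) ≠ Sum.inr r → w (Sum.inr r) < t)
    (hσ : ¬ Set.MapsTo σ (Set.range Sum.inl) (Set.range Sum.inl)) :
    weight (w ∘ σ ∘ Sum.inl) < weight (w ∘ Sum.inl) := by
  set U : Finset (K ⊕ K) := Finset.univ.map Function.Embedding.inl
  set U' : Finset (K ⊕ K) := U.map σ.toEmbedding
  have h1 : weight (w ∘ σ ∘ Sum.inl) = ∑ p ∈ U', 2 ^ w p := by
    simp [U', U, weight]
  have h2 : weight (w ∘ Sum.inl) = ∑ p ∈ U, 2 ^ w p := by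
    simp [U, weight]
  have hcard : U'.card = U.card := Finset.card_map _
  rw [h1, h2, ← Finset.sum_inter_add_sum_sdiff U' U, ← Finset.sum_inter_add_sum_sdiff U U',
    Finset.inter_comm U U', add_lt_add_iff_left]
  have hne : (U' \ U).Nonempty := by
    rw [Set.mapsTo_range_iff] at hσ
    push Not at hσ
    obtain ⟨r, hr⟩ := hσ
    refine ⟨σ (Sum.inl r), Finset.mem_sdiff.2 ⟨by simp [U', U], ?_⟩⟩
    simpa [U] using hr
  calc ∑ p ∈ U' \ U, 2 ^ w p < ∑ p ∈ U' \ U, 2 ^ t := by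
        refine Finset.sum_lt_sum_of_nonempty hne fun p hp => Nat.pow_lt_pow_right (by norm_num) ?_
        obtain ⟨h3, h4⟩ := Finset.mem_sdiff.1 hp
        rcases p with r | r
        · exact absurd (by simp [U]) h4
        · refine hr r fun h => ?_
          obtain ⟨q, hq, hq'⟩ := Finset.mem_map.1 h3
          have : q = Sum.inr r := σ.injective (hq'.trans h.symm)
          simp [U, this] at hq
    _ = ∑ p ∈ U \ U', 2 ^ t := by
        rw [Finset.sum_const, Finset.sum_const, Finset.card_sdiff_comm hcard]
    _ ≤ ∑ p ∈ U \ U', 2 ^ w p := by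
        refine Finset.sum_le_sum fun p hp => Nat.pow_le_pow_right (by norm_num) ?_
        obtain ⟨h3, h4⟩ := Finset.mem_sdiff.1 hp
        rcases p with r | r
        · refine hl r fun h => h4 (Finset.mem_map.2 ⟨Sum.inl r, h3, h⟩)
        · simp [U] at h3

variable {R : Type*} [CommRing R] [Algebra ℂ R]

lemma mem_span_of_card_lt_card (Y : Matrix K ℕ R) (c d : K → ℕ) (t : ℕ)
    (h : (Finset.univ.filter fun r => c r < t).card < (Finset.univ.filter fun r => d r < t).card) :
    bracket Y c * bracket Y d ∈ Submodule.span ℂ {f | ∃ c' d' : K → ℕ, weight c' < weight c ∧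
      weight c' + weight d' = weight c + weight d ∧ f = bracket Y c' * bracket Y d'} := by
  classical
  set H := Submodule.span ℂ {f | ∃ c' d' : K → ℕ, weight c' < weight c ∧
      weight c' + weight d' = weight c + weight d ∧ f = bracket Y c' * bracket Y d'}
  set w : K ⊕ K → ℕ := Sum.elim c d
  set T : Finset (K ⊕ K) := (Finset.univ.filter fun r => ¬ c r < t).disjSum
    (Finset.univ.filter fun r => d r < t) with hT
  have hcard : Fintype.card K < T.card := by
    rw [hT, Finset.card_disjSum]
    have := Finset.card_filter_add_card_filter_not (s := (Finset.univ : Finset K)) (fun r => c r < t)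
    rw [Finset.card_univ] at this
    omega
  have hsum := sum_perm_bracket_mul_bracket Y w T hcard
  rw [← Finset.sum_filter_add_sum_filter_not _ (fun σ : Equiv.Perm T =>
    Set.MapsTo (Equiv.Perm.ofSubtype σ : Equiv.Perm (K ⊕ K)) (Set.range Sum.inl)
      (Set.range Sum.inl))] at hsum
  rw [Finset.sum_congr rfl (g := fun _ => bracket Y c * bracket Y d), Finset.sum_const] at hsum
  swap
  · intro σ hσ
    rw [← Equiv.Perm.sign_ofSubtype σ]
    exact sign_mul_bracket_mul_bracket Y w _ (Finset.mem_filter.1 hσ).2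
  set m := (Finset.univ.filter fun σ : Equiv.Perm T => Set.MapsTo
    (Equiv.Perm.ofSubtype σ : Equiv.Perm (K ⊕ K)) (Set.range Sum.inl) (Set.range Sum.inl)).card with hm
  have hm0 : (m : ℂ) ≠ 0 := by
    rw [Nat.cast_ne_zero, hm]
    refine (Finset.card_pos.2 ⟨1, ?_⟩).ne'
    simp
  have hmem : (m : ℂ) • (bracket Y c * bracket Y d) ∈ H := by
    rw [Nat.cast_smul_eq_nsmul, eq_neg_of_add_eq_zero_left hsum]
    refine H.neg_mem (H.sum_mem fun σ hσ => ?_)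
    have h1 : ∀ p, (Equiv.Perm.ofSubtype σ : Equiv.Perm (K ⊕ K)) p ≠ p → p ∈ T := fun p hp => by
      by_contra h
      exact hp (Equiv.Perm.ofSubtype_apply_of_not_mem σ h)
    have h2 : bracket Y (w ∘ (Equiv.Perm.ofSubtype σ : Equiv.Perm (K ⊕ K)) ∘ Sum.inl) *
        bracket Y (w ∘ (Equiv.Perm.ofSubtype σ : Equiv.Perm (K ⊕ K)) ∘ Sum.inr) ∈ H := by
      refine Submodule.subset_span ⟨_, _, ?_, weight_comp_add w _, rfl⟩
      refine weight_comp_lt w t _ (fun r hr => ?_) (fun r hr => ?_) (Finset.mem_filter.1 hσ).2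
      · simpa [hT, w] using h1 _ hr
      · simpa [hT, w] using h1 _ hr
    rw [← zsmul_eq_mul]
    exact H.toAddSubgroup.zsmul_mem h2 _
  exact (H.smul_mem_iff hm0).1 hmem

end Weight

section SymplecticStraightening

lemma sum_eq_zero_of_sum_update_eq_zero {ι α V : Type*} [Fintype ι] [DecidableEq ι] [Fintype α]
    [AddCommMonoid V] (f : (ι → α) → V) (i : ι)
    (h : ∀ e, ∑ u, f (Function.update e i u) = 0) : ∑ e, f e = 0 := by
  rw [← Equiv.sum_comp (Equiv.funSplitAt i α).symm, Fintype.sum_prod_type_right]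
  refine Finset.sum_eq_zero fun e' _ => ?_
  rcases isEmpty_or_nonempty α with hα | ⟨⟨u₀⟩⟩
  · simp
  rw [← h ((Equiv.funSplitAt i α).symm (u₀, e'))]
  refine Finset.sum_congr rfl fun u _ => congrArg f (funext fun j => ?_)
  by_cases hj : j = i
  · subst hj; simp [Equiv.funSplitAt]
  · simp [Equiv.funSplitAt, hj]

/-- A symmetric family indexed by the maps `ι → ι ⊕ ζ` that vanishes on noninjective maps and
sums to zero in each coordinate is zero when `ζ` is smaller than `ι`. -/
lemma eq_zero_of_sum_update_eq_zero {ι ζ V : Type*} [Fintype ι] [DecidableEq ι] [Fintype ζ]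
    [AddCommGroup V] [Module ℂ V] (hcard : Fintype.card ζ < Fintype.card ι)
    (G : (ι → ι ⊕ ζ) → V) (hsum : ∀ e i, ∑ x, G (Function.update e i x) = 0)
    (hinj : ∀ e, ¬ Function.Injective e → G e = 0)
    (hsymm : ∀ f : ι → ι, Function.Bijective f → G (Sum.inl ∘ f) = G Sum.inl) :
    G Sum.inl = 0 := by
  classical
  set S : Finset ι → V := fun K => ∑ e : ι → ι ⊕ ζ, if ∀ j, (e j).isLeft ↔ j ∈ K then G e else 0
  have hS : ∀ K i, i ∉ K → S K + S (insert i K) = 0 := by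
    intro K i hi
    simp only [S]
    rw [← Finset.sum_add_distrib]
    refine sum_eq_zero_of_sum_update_eq_zero _ i fun e => ?_
    by_cases hq : ∀ j ≠ i, (e j).isLeft ↔ j ∈ K
    · refine (Finset.sum_congr rfl fun x _ => ?_).trans (hsum e i)
      have h1 : (∀ j, (Function.update e i x j).isLeft ↔ j ∈ K) ↔ ¬ x.isLeft := by
        refine ⟨fun h => by simpa [hi] using h i, fun h j => ?_⟩
        by_cases hj : j = i
        · subst hj; simpa [hi] using h
        · simpa [hj] using hq j hj
      have h2 : (∀ j, (Function.update e i x j).isLeft ↔ j ∈ insert i K) ↔ x.isLeft := by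
        refine ⟨fun h => by simpa using h i, fun h j => ?_⟩
        by_cases hj : j = i
        · subst hj; simpa using h
        · simpa [hj] using hq j hj
      simp only [h1, h2]
      by_cases hx : x.isLeft <;> simp [hx]
    · refine Finset.sum_eq_zero fun x _ => ?_
      push Not at hq
      obtain ⟨j, hj, hne⟩ := hq
      have hne' : ¬ ((e j).isLeft ↔ j ∈ K) := by tauto
      rw [if_neg fun h => hne' (by simpa [hj] using h j),
        if_neg fun h => hne' (by simpa [hj] using h j), add_zero]
  have h0 : S ∅ = 0 := by
    refine Finset.sum_eq_zero fun e _ => ?_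
    split_ifs with h
    · refine hinj e fun he => ?_
      have hright : ∀ j, ∃ z, e j = Sum.inr z := fun j => by
        have := h j
        rcases hej : e j with x | z
        · simp [hej] at this
        · exact ⟨z, rfl⟩
      choose z hz using hright
      refine hcard.not_ge (Fintype.card_le_of_injective z fun a b hab => he ?_)
      rw [hz, hz, hab]
    · rfl
  have hall : ∀ K, S K = 0 := by
    intro K
    induction K using Finset.induction_on with
    | empty => exact h0
    | insert i K hi ih => simpa [ih] using hS K i hi
  have huniv : S Finset.univ =
      ((Finset.univ.filter fun f : ι → ι => Function.Bijective f).card : ℂ) • G Sum.inl := by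
    rw [Nat.cast_smul_eq_nsmul, ← Finset.sum_const]
    refine (Finset.sum_filter _ _).symm.trans ?_
    symm
    refine (Finset.sum_congr rfl fun f hf => (hsymm f (Finset.mem_filter.1 hf).2).symm).trans ?_
    refine Finset.sum_bij_ne_zero (fun f _ _ => Sum.inl ∘ f) (fun f _ _ => by simp)
      (fun f _ _ g _ _ h => funext fun j => Sum.inl_injective (congrFun h j)) (fun e he hne => ?_)
      (fun f _ _ => rfl)
    have hleft : ∀ j, ∃ z, e j = Sum.inl z := fun j => by
      have := (Finset.mem_filter.1 he).2 j
      rcases hej : e j with x | z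
      · exact ⟨x, rfl⟩
      · simp [hej] at this
    choose f hf using hleft
    have hef : e = Sum.inl ∘ f := funext hf
    have hfinj : Function.Injective f := by
      by_contra h
      exact hne (hinj e fun he => h fun a b hab => he (by rw [hf, hf, hab]))
    exact ⟨f, Finset.mem_filter.2 ⟨Finset.mem_univ _, hfinj.bijective_of_finite⟩, hef ▸ hne, hef.symm⟩
  rw [hall] at huniv
  refine (smul_eq_zero.1 huniv.symm).resolve_left ?_
  exact Nat.cast_ne_zero.2 (Finset.card_pos.2 ⟨id, by simp⟩).ne'

/-- Replace the pairs of columns `2 * u, 2 * u + 1` with `u ∈ P` according to `e`. -/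
def movePairs (P : Finset ℕ) (e : P → ℕ) (j : ℕ) : ℕ :=
  if h : j / 2 ∈ P then 2 * e ⟨j / 2, h⟩ + j % 2 else j

lemma movePairs_coe (P : Finset ℕ) : movePairs P (fun u => u) = id := by
  funext j
  unfold movePairs
  split_ifs
  · simp only [id]; omega
  · rfl

lemma movePairs_even {P : Finset ℕ} (e : P → ℕ) (u : P) : movePairs P e (2 * u) = 2 * e u := by
  have h : 2 * (u : ℕ) / 2 = u := by omega
  simp [movePairs, h]

lemma movePairs_odd {P : Finset ℕ} (e : P → ℕ) (u : P) :
    movePairs P e (2 * u + 1) = 2 * e u + 1 := by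
  have h : (2 * (u : ℕ) + 1) / 2 = u := by omega
  have h' : (2 * (u : ℕ) + 1) % 2 = 1 := by omega
  simp [movePairs, h, h']

lemma movePairs_of_notMem {P : Finset ℕ} (e : P → ℕ) {j : ℕ} (hj : j / 2 ∉ P) :
    movePairs P e j = j := by
  simp [movePairs, hj]

lemma weight_lt_weight_movePairs {K : Type*} [Fintype K] {P : Finset ℕ} {c : K → ℕ}
    (hc : Function.Injective c) {s : ℕ}
    (hP : ∀ u ∈ P, u < s) {r₀ : P → K} (h₀ : ∀ u, c (r₀ u) = 2 * u) (e : P → ℕ) {u : P}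
    (hu : s ≤ e u) : weight c < weight (movePairs P e ∘ c) := by
  classical
  unfold weight
  rw [← Finset.sum_filter_add_sum_filter_not _ (fun r => c r / 2 ∈ P),
    ← Finset.sum_filter_add_sum_filter_not _ (fun r => c r / 2 ∈ P) (fun r => 2 ^ (_ ∘ c) r)]
  refine add_lt_add_of_lt_of_le ?_ (Finset.sum_le_sum fun r hr => ?_)
  · calc ∑ r ∈ Finset.univ.filter (fun r => c r / 2 ∈ P), 2 ^ c r
        = ∑ j ∈ (Finset.univ.filter (fun r => c r / 2 ∈ P)).image c, 2 ^ j := by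
          rw [Finset.sum_image fun a _ b _ h => hc h]
      _ ≤ ∑ j ∈ Finset.range (2 * s), 2 ^ j := by
          refine Finset.sum_le_sum_of_subset fun j hj => ?_
          obtain ⟨r, hr, rfl⟩ := Finset.mem_image.1 hj
          have := hP _ (Finset.mem_filter.1 hr).2
          rw [Finset.mem_range]
          omega
      _ < 2 ^ (2 * s) := Nat.geomSum_lt le_rfl fun j hj => Finset.mem_range.1 hj
      _ ≤ 2 ^ (movePairs P e ∘ c) (r₀ u) := by
          refine Nat.pow_le_pow_right (by norm_num) ?_
          rw [Function.comp_apply, h₀, movePairs_even]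
          omega
      _ ≤ _ := by
          refine Finset.single_le_sum (f := fun r => 2 ^ (movePairs P e ∘ c) r)
            (fun _ _ => Nat.zero_le _) ?_
          rw [Finset.mem_filter, h₀, Nat.mul_div_cancel_left _ (by norm_num)]
          exact ⟨Finset.mem_univ _, u.2⟩
  · rw [Function.comp_apply, movePairs_of_notMem _ (Finset.mem_filter.1 hr).2]

variable {K R : Type*} [Fintype K] [DecidableEq K] [CommRing R]

lemma sum_bracket_update (Y : Matrix K ℕ R) (n : ℕ)
    (hY : ∀ i j, ∑ u ∈ Finset.range n,
      (Y i (2 * u) * Y j (2 * u + 1) - Y j (2 * u) * Y i (2 * u + 1)) = 0)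
    (c : K → ℕ) {r₁ r₂ : K} (hr : r₁ ≠ r₂) :
    ∑ u ∈ Finset.range n,
      bracket Y (Function.update (Function.update c r₁ (2 * u)) r₂ (2 * u + 1)) = 0 := by
  set ω : K → K → R := fun i j => ∑ u ∈ Finset.range n, Y i (2 * u) * Y j (2 * u + 1)
  have hω : ∀ i j, ω i j = ω j i := fun i j => by
    rw [← sub_eq_zero, ← Finset.sum_sub_distrib]; exact hY i j
  have h1 : ∀ (u : ℕ) (τ : Equiv.Perm K),
      ∏ r, Y (τ r) (Function.update (Function.update c r₁ (2 * u)) r₂ (2 * u + 1) r) =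
        (Y (τ r₁) (2 * u) * Y (τ r₂) (2 * u + 1)) *
          ∏ r ∈ (Finset.univ.erase r₂).erase r₁, Y (τ r) (c r) := by
    intro u τ
    rw [← Finset.mul_prod_erase _ _ (Finset.mem_univ r₂),
      ← Finset.mul_prod_erase _ _ (Finset.mem_erase.2 ⟨hr, Finset.mem_univ r₁⟩)]
    rw [Finset.prod_congr rfl (g := fun r => Y (τ r) (c r))]
    · simp [hr]
      ring
    · intro r hr'
      simp only [Finset.mem_erase] at hr'
      simp [hr'.1, hr'.2.1]
  simp_rw [bracket_apply, h1]
  rw [Finset.sum_comm]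
  have h2 : ∀ τ : Equiv.Perm K, ∑ u ∈ Finset.range n, ((Equiv.Perm.sign τ : ℤ) : R) *
      ((Y (τ r₁) (2 * u) * Y (τ r₂) (2 * u + 1)) *
          ∏ r ∈ (Finset.univ.erase r₂).erase r₁, Y (τ r) (c r)) =
      ((Equiv.Perm.sign τ : ℤ) : R) * (ω (τ r₁) (τ r₂) *
        ∏ r ∈ (Finset.univ.erase r₂).erase r₁, Y (τ r) (c r)) := fun τ => by
    rw [← Finset.mul_sum, ← Finset.sum_mul]
  rw [Finset.sum_congr rfl fun τ _ => h2 τ]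
  refine Finset.sum_involution (fun τ _ => τ * Equiv.swap r₁ r₂) (fun τ _ => ?_) (fun τ _ _ h => ?_)
    (fun _ _ => Finset.mem_univ _) (fun τ _ => by simp [mul_assoc])
  · have h3 : ∏ r ∈ (Finset.univ.erase r₂).erase r₁, Y ((τ * Equiv.swap r₁ r₂) r) (c r) =
        ∏ r ∈ (Finset.univ.erase r₂).erase r₁, Y (τ r) (c r) := by
      refine Finset.prod_congr rfl fun r hr' => ?_
      simp only [Finset.mem_erase] at hr'
      rw [Equiv.Perm.mul_apply, Equiv.swap_apply_of_ne_of_ne hr'.1 hr'.2.1]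
    rw [h3, Equiv.Perm.sign_mul, Equiv.Perm.sign_swap hr]
    simp [hω (τ r₂)]
  · have := congrArg (fun π : Equiv.Perm K => π r₁) (mul_eq_left.1 h)
    exact hr (by simpa using this.symm)

lemma bracket_movePairs_comp_perm (Y : Matrix K ℕ R) {P : Finset ℕ} {c : K → ℕ}
    (hc : Function.Injective c) {r₀ r₁ : P → K} (h₀ : ∀ u, c (r₀ u) = 2 * u)
    (h₁ : ∀ u, c (r₁ u) = 2 * u + 1) (σ : Equiv.Perm P) :
    bracket Y (movePairs P (fun u => σ u) ∘ c) = bracket Y c := by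
  classical
  have hr₀ : Function.Injective r₀ := fun a b hab => by
    have := congrArg c hab
    rw [h₀, h₀] at this
    exact Subtype.ext (by omega)
  have hr₁ : Function.Injective r₁ := fun a b hab => by
    have := congrArg c hab
    rw [h₁, h₁] at this
    exact Subtype.ext (by omega)
  set π : Equiv.Perm K := σ.viaFintypeEmbedding ⟨r₀, hr₀⟩ * σ.viaFintypeEmbedding ⟨r₁, hr₁⟩
  have hmem₀ : ∀ r, r ∈ Set.range r₀ ↔ ∃ u : P, c r = 2 * u := fun r =>
    ⟨by rintro ⟨u, rfl⟩; exact ⟨u, h₀ u⟩, fun ⟨u, hu⟩ => ⟨u, hc ((h₀ u).trans hu.symm)⟩⟩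
  have hmem₁ : ∀ r, r ∈ Set.range r₁ ↔ ∃ u : P, c r = 2 * u + 1 := fun r =>
    ⟨by rintro ⟨u, rfl⟩; exact ⟨u, h₁ u⟩, fun ⟨u, hu⟩ => ⟨u, hc ((h₁ u).trans hu.symm)⟩⟩
  have hπ : movePairs P (fun u => σ u) ∘ c = c ∘ π := by
    funext r
    simp only [Function.comp_apply, π, Equiv.Perm.mul_apply]
    by_cases hr1 : r ∈ Set.range r₁
    · obtain ⟨u, rfl⟩ := hr1
      have e1 : σ.viaFintypeEmbedding ⟨r₁, hr₁⟩ (r₁ u) = r₁ (σ u) :=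
        Equiv.Perm.viaFintypeEmbedding_apply_image σ ⟨r₁, hr₁⟩ u
      rw [e1, Equiv.Perm.viaFintypeEmbedding_apply_notMem_range, h₁, h₁, movePairs_odd]
      change r₁ (σ u) ∉ Set.range r₀
      rw [hmem₀, h₁]
      rintro ⟨v, hv⟩
      omega
    · rw [Equiv.Perm.viaFintypeEmbedding_apply_notMem_range σ ⟨r₁, hr₁⟩ hr1]
      by_cases hr0 : r ∈ Set.range r₀
      · obtain ⟨u, rfl⟩ := hr0
        have e1 : σ.viaFintypeEmbedding ⟨r₀, hr₀⟩ (r₀ u) = r₀ (σ u) :=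
          Equiv.Perm.viaFintypeEmbedding_apply_image σ ⟨r₀, hr₀⟩ u
        rw [e1, h₀, h₀, movePairs_even]
      · rw [Equiv.Perm.viaFintypeEmbedding_apply_notMem_range σ ⟨r₀, hr₀⟩ hr0]
        refine movePairs_of_notMem _ fun h => ?_
        rcases Nat.mod_two_eq_zero_or_one (c r) with h2 | h2
        · exact hr0 ((hmem₀ r).2 ⟨⟨_, h⟩, by simp only; omega⟩)
        · exact hr1 ((hmem₁ r).2 ⟨⟨_, h⟩, by simp only; omega⟩)
  rw [hπ, bracket_comp_perm]
  simp only [π, Equiv.Perm.sign_mul, Equiv.Perm.viaFintypeEmbedding_sign, Int.units_mul_self]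
  simp

end SymplecticStraightening

section Straightening

variable {K R : Type*} [Fintype K] [DecidableEq K] [CommRing R] [Algebra ℂ R]

lemma card_filter_lt_add_card_le {c : K → ℕ} (hc : Function.Injective c) (s : ℕ) :
    (Finset.univ.filter fun r => c r < 2 * s).card +
        ((Finset.range s).filter fun u => (∀ r, c r ≠ 2 * u) ∧ ∀ r, c r ≠ 2 * u + 1).card ≤
      s + ((Finset.range s).filter fun u => (∃ r, c r = 2 * u) ∧ ∃ r, c r = 2 * u + 1).card := by
  classical
  rw [Finset.card_eq_sum_card_fiberwise (f := fun r => c r / 2) (t := Finset.range s)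
    fun r hr => by
      have : c r < 2 * s := by simpa using hr
      simpa using by omega]
  rw [Finset.card_filter, Finset.card_filter]
  conv_rhs => lhs; rw [← Finset.card_range s, Finset.card_eq_sum_ones]
  rw [← Finset.sum_add_distrib, ← Finset.sum_add_distrib]
  refine Finset.sum_le_sum fun u _ => ?_
  have h0 : (Finset.univ.filter fun r => c r = 2 * u).card ≤ 1 :=
    Finset.card_le_one.2 fun a ha b hb => hc (by simp at ha hb; rw [ha, hb])
  have h1 : (Finset.univ.filter fun r => c r = 2 * u + 1).card ≤ 1 :=
    Finset.card_le_one.2 fun a ha b hb => hc (by simp at ha hb; rw [ha, hb])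
  have h2 : ((Finset.univ.filter fun r => c r < 2 * s).filter fun r => c r / 2 = u) ⊆
      (Finset.univ.filter fun r => c r = 2 * u) ∪ Finset.univ.filter fun r => c r = 2 * u + 1 := by
    intro r hr
    simp at hr ⊢
    omega
  have h3 := (Finset.card_le_card h2).trans (Finset.card_union_le _ _)
  have h0' : (Finset.univ.filter fun r => c r = 2 * u).card = 0 ↔ ∀ r, c r ≠ 2 * u := by
    simp [Finset.filter_eq_empty_iff]
  have h1' : (Finset.univ.filter fun r => c r = 2 * u + 1).card = 0 ↔ ∀ r, c r ≠ 2 * u + 1 := by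
    simp [Finset.filter_eq_empty_iff]
  have e0 : (∃ r, c r = 2 * u) ↔ ¬ ∀ r, c r ≠ 2 * u := by push Not; rfl
  have e1 : (∃ r, c r = 2 * u + 1) ↔ ¬ ∀ r, c r ≠ 2 * u + 1 := by push Not; rfl
  simp only [e0, e1, ← h0', ← h1']
  split_ifs <;> omega

lemma bracket_mem_span_of_lt_card (Y : Matrix K ℕ R) (n : ℕ)
    (hY : ∀ i j, ∑ u ∈ Finset.range n,
      (Y i (2 * u) * Y j (2 * u + 1) - Y j (2 * u) * Y i (2 * u + 1)) = 0)
    {c : K → ℕ} (hc : Function.Injective c) {s : ℕ} (hs : s ≤ n)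
    (hcs : s < (Finset.univ.filter fun r => c r < 2 * s).card) :
    bracket Y c ∈ Submodule.span ℂ {f | ∃ c', weight c < weight c' ∧ f = bracket Y c'} := by
  set H := Submodule.span ℂ {f | ∃ c', weight c < weight c' ∧ f = bracket Y c'}
  set P := (Finset.range s).filter fun u => (∃ r, c r = 2 * u) ∧ ∃ r, c r = 2 * u + 1 with hP
  set Z := (Finset.range s).filter fun u => (∀ r, c r ≠ 2 * u) ∧ ∀ r, c r ≠ 2 * u + 1 with hZ
  classical
  have hPs : ∀ u ∈ P, u < s := fun u hu => by simp [hP] at hu; exact hu.1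
  have hcard : Fintype.card Z < Fintype.card P := by
    have : (Finset.univ.filter fun r => c r < 2 * s).card + Z.card ≤ s + P.card := by
      convert card_filter_lt_add_card_le hc s
    rw [Fintype.card_coe, Fintype.card_coe]
    omega
  have h01 : ∀ u : P, (∃ r, c r = 2 * u) ∧ ∃ r, c r = 2 * u + 1 := fun u =>
    (Finset.mem_filter.1 u.2).2
  choose r₀ h₀ using fun u => (h01 u).1
  choose r₁ h₁ using fun u => (h01 u).2
  have hdisj : Disjoint P Z := by
    rw [Finset.disjoint_left]
    intro u hu hu'
    obtain ⟨r, hr⟩ := (Finset.mem_filter.1 hu).2.1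
    exact (Finset.mem_filter.1 hu').2.1 r hr
  let v : P ⊕ Z → ℕ := Sum.elim (fun u => u) fun u => u
  have hv : ∀ (f : ℕ → R), ∑ x, f (v x) = ∑ u ∈ P ∪ Z, f u := fun f => by
    rw [Finset.sum_union hdisj, Fintype.sum_sum_type, ← Finset.sum_coe_sort P, ← Finset.sum_coe_sort Z]
    rfl
  let g : (P → ℕ) → R := fun e => bracket Y (movePairs P e ∘ c)
  have hgnot : ∀ (e : P → ℕ) (i : P) (u : ℕ), e i = u → u ∈ Finset.range n → u ∉ P ∪ Z →
      g e ∈ H := by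
    intro e i u hei hun hu
    by_cases hus : s ≤ u
    · exact Submodule.subset_span ⟨_, weight_lt_weight_movePairs hc hPs h₀ e (hei ▸ hus), rfl⟩
    · have : g e = 0 := by
        apply bracket_eq_zero_of_not_injective
        intro hinj
        rw [Finset.mem_union, not_or] at hu
        have huP : ¬ ((∃ r, c r = 2 * u) ∧ ∃ r, c r = 2 * u + 1) := fun h =>
          hu.1 (Finset.mem_filter.2 ⟨by simpa using hus, h⟩)
        have huZ : ¬ ((∀ r, c r ≠ 2 * u) ∧ ∀ r, c r ≠ 2 * u + 1) := fun h =>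
          hu.2 (Finset.mem_filter.2 ⟨by simpa using hus, h⟩)
        have hor : (∃ r, c r = 2 * u) ∨ ∃ r, c r = 2 * u + 1 := by
          by_contra h
          push Not at h
          exact huZ h
        rcases hor with ⟨r, hr⟩ | ⟨r, hr⟩
        · have h2 : r = r₀ i := hinj (by
            rw [Function.comp_apply, Function.comp_apply, h₀, movePairs_even, hr, hei]
            refine movePairs_of_notMem e ?_
            rw [Nat.mul_div_cancel_left _ (by norm_num)]
            exact hu.1)
          rw [h2, h₀] at hr
          exact hu.1 ((by omega : (i : ℕ) = u) ▸ i.2)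
        · have h2 : r = r₁ i := hinj (by
            rw [Function.comp_apply, Function.comp_apply, h₁, movePairs_odd, hr, hei]
            refine movePairs_of_notMem e ?_
            rw [show (2 * u + 1) / 2 = u by omega]
            exact hu.1)
          rw [h2, h₁] at hr
          exact hu.1 ((by omega : (i : ℕ) = u) ▸ i.2)
      rw [this]
      exact H.zero_mem
  have hupd : ∀ (e : P → ℕ) (i : P) (u : ℕ), movePairs P (Function.update e i u) ∘ c =
      Function.update (Function.update (movePairs P e ∘ c) (r₀ i) (2 * u)) (r₁ i) (2 * u + 1) := by
    intro e i u
    funext r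
    by_cases hr1 : r = r₁ i
    · subst hr1
      simp [h₁, movePairs_odd]
    by_cases hr0 : r = r₀ i
    · subst hr0
      simp [hr1, h₀, movePairs_even]
    · simp only [Function.update_of_ne hr1, Function.update_of_ne hr0, Function.comp_apply, movePairs]
      split_ifs with h
      · rw [Function.update_of_ne]
        rintro rfl
        rcases Nat.mod_two_eq_zero_or_one (c r) with h2 | h2
        · exact hr0 (hc (by rw [h₀]; simp only; omega))
        · exact hr1 (hc (by rw [h₁]; simp only; omega))
      · rfl
  have hmain : H.mkQ (g fun u => u) = 0 := by
    refine eq_zero_of_sum_update_eq_zero (V := R ⧸ H) hcard (fun e => H.mkQ (g (v ∘ e)))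
      (fun e i => ?_) (fun e he => ?_) (fun f hf => ?_)
    · rw [← map_sum, ← LinearMap.mem_ker, Submodule.ker_mkQ]
      have h2 : ∀ x, v ∘ Function.update e i x = Function.update (v ∘ e) i (v x) := fun x =>
        Function.comp_update v e i x
      simp_rw [h2]
      rw [hv fun u => g (Function.update (v ∘ e) i u)]
      have hsub : P ∪ Z ⊆ Finset.range n := by
        refine (Finset.union_subset (Finset.filter_subset _ _) (Finset.filter_subset _ _)).trans ?_
        exact Finset.range_subset_range.2 hs
      have h3 : ∑ u ∈ Finset.range n, g (Function.update (v ∘ e) i u) = 0 := by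
        simp only [g, hupd]
        refine sum_bracket_update Y n hY _ fun h => ?_
        have := congrArg c h
        rw [h₀, h₁] at this
        omega
      rw [← Finset.sum_sdiff hsub] at h3
      rw [eq_neg_of_add_eq_zero_right h3]
      refine H.neg_mem (H.sum_mem fun u hu => ?_)
      exact hgnot _ i u (by simp) (Finset.mem_sdiff.1 hu).1 (Finset.mem_sdiff.1 hu).2
    · rw [Function.Injective] at he
      push Not at he
      obtain ⟨a, b, hab, hne⟩ := he
      have : g (v ∘ e) = 0 := by
        apply bracket_eq_zero_of_not_injective
        intro hinj
        have h2 : r₀ a = r₀ b := hinj (by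
          simp only [Function.comp_apply]
          rw [h₀, h₀, movePairs_even, movePairs_even, Function.comp_apply, Function.comp_apply, hab])
        have := congrArg c h2
        rw [h₀, h₀] at this
        exact hne (Subtype.ext (by omega))
      rw [this, map_zero]
    · have h1 := bracket_movePairs_comp_perm Y hc h₀ h₁ (Equiv.ofBijective f hf)
      have h2 : g (v ∘ Sum.inl ∘ f) = g (v ∘ Sum.inl) := by
        refine h1.trans ?_
        have : movePairs P (v ∘ Sum.inl) = id := movePairs_coe P
        simp only [g, this]
        rfl
      rw [h2]
  rw [← LinearMap.mem_ker, Submodule.ker_mkQ] at hmain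
  have : g (fun u => u) = bracket Y c := by
    simp only [g, movePairs_coe]
    rfl
  rwa [this] at hmain

/-- The order on column selections: entrywise comparison of the increasing rearrangements. -/
def colLE (c d : K → ℕ) : Prop :=
  ∀ t, (Finset.univ.filter fun r => d r < t).card ≤ (Finset.univ.filter fun r => c r < t).card

lemma mul_mem_of_mem_span {S : Set R} {V : Submodule ℂ R} {x z : R} (hx : x ∈ Submodule.span ℂ S)
    (h : ∀ y ∈ S, y * z ∈ V) : x * z ∈ V :=
  (Submodule.span_le (p := V.comap (LinearMap.mulRight ℂ z))).2 h hx

lemma sq_add_sq_lt_of_lt {a b a' b' : ℕ} (hab : a ≤ b) (h : a' < a) (h' : a' + b' = a + b) :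
    a ^ 2 + b ^ 2 < a' ^ 2 + b' ^ 2 := by
  obtain ⟨x, rfl⟩ := Nat.exists_eq_add_of_lt h
  obtain ⟨y, rfl⟩ := Nat.exists_eq_add_of_le hab
  obtain rfl : b' = a' + x + 1 + y + (x + 1) := by omega
  nlinarith

lemma list_prod_bracket_mem (Y : Matrix K ℕ R) (n B : ℕ)
    (hY : ∀ i j, ∑ u ∈ Finset.range n,
      (Y i (2 * u) * Y j (2 * u + 1) - Y j (2 * u) * Y i (2 * u + 1)) = 0)
    (hB : ∀ c : K → ℕ, (∃ r, B ≤ c r) → bracket Y c = 0) (V : Submodule ℂ R)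
    (hV : ∀ L : List (K → ℕ), (∀ c ∈ L, Function.Injective c ∧ (∀ r, c r < B) ∧
      ∀ s ≤ n, (Finset.univ.filter fun r => c r < 2 * s).card ≤ s) → L.Pairwise colLE →
        (L.map (bracket Y)).prod ∈ V) (L : List (K → ℕ)) : (L.map (bracket Y)).prod ∈ V := by
  classical
  set b := Fintype.card K * 2 ^ B
  have hb : ∀ c : K → ℕ, (∀ r, c r < B) → weight c ≤ b := fun c hc => by
    unfold weight
    refine (Finset.sum_le_card_nsmul _ _ (2 ^ B) fun r _ =>
      Nat.pow_le_pow_right (by norm_num) (hc r).le).trans ?_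
    simp [b]
  have hzero : ∀ (L : List (K → ℕ)) c, c ∈ L → bracket Y c = 0 → (L.map (bracket Y)).prod ∈ V := by
    intro L c hc h
    rw [List.prod_eq_zero (h ▸ List.mem_map_of_mem hc)]
    exact V.zero_mem
  have key : ∀ (N : ℕ) (L : List (K → ℕ)),
      L.length * b ^ 2 < (L.map fun c => weight c ^ 2).sum + N → (L.map (bracket Y)).prod ∈ V := by
    intro N
    induction N with
    | zero =>
      intro L hL
      by_contra hne
      have h1 : ∀ c ∈ L, ∀ r, c r < B := fun c hc r => by
        by_contra h
        exact hne (hzero L c hc (hB c ⟨r, not_lt.1 h⟩))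
      have h2 := List.sum_le_card_nsmul (L.map fun c => weight c ^ 2) (b ^ 2) (by
        simp only [List.mem_map]
        rintro _ ⟨c, hc, rfl⟩
        exact Nat.pow_le_pow_left (hb c (h1 c hc)) 2)
      simp at h2 hL
      omega
    | succ N ih =>
      intro L₀ hL₀
      set L := L₀.insertionSort (fun c d => weight c ≤ weight d)
      have hperm : L.Perm L₀ := List.perm_insertionSort _ _
      rw [← (hperm.map _).prod_eq]
      rw [← hperm.length_eq, ← (hperm.map _).sum_eq] at hL₀
      have : Std.Total (fun c d : K → ℕ => weight c ≤ weight d) := ⟨fun c d => le_total _ _⟩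
      have : IsTrans (K → ℕ) (fun c d : K → ℕ => weight c ≤ weight d) := ⟨fun _ _ _ => le_trans⟩
      have hsort : L.Pairwise (fun c d => weight c ≤ weight d) := List.pairwise_insertionSort _ _
      by_cases hgood : ∀ c ∈ L, Function.Injective c ∧ (∀ r, c r < B) ∧
          ∀ s ≤ n, (Finset.univ.filter fun r => c r < 2 * s).card ≤ s
      · by_cases hpair : L.Pairwise colLE
        · exact hV L hgood hpair
        · rw [List.pairwise_iff_forall_sublist] at hpair
          push Not at hpair
          obtain ⟨c, d, hcd, hnot⟩ := hpair
          have hw : weight c ≤ weight d := List.pairwise_iff_forall_sublist.1 hsort hcd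
          obtain ⟨l, hl⟩ := hcd.exists_perm_append
          rw [(hl.map _).prod_eq]
          rw [hl.length_eq, (hl.map _).sum_eq] at hL₀
          unfold colLE at hnot
          push Not at hnot
          obtain ⟨t, ht⟩ := hnot
          have e : ∀ c d : K → ℕ, (([c, d] ++ l).map (bracket Y)).prod =
            (bracket Y c * bracket Y d) * (l.map (bracket Y)).prod := by simp [mul_assoc]
          rw [e]
          refine mul_mem_of_mem_span (mem_span_of_card_lt_card Y c d t ht) ?_
          rintro _ ⟨c', d', h1, h2, rfl⟩
          rw [← e]
          apply ih
          have := sq_add_sq_lt_of_lt hw h1 h2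
          simp at hL₀ ⊢
          omega
      · push Not at hgood
        obtain ⟨c, hc, hbad⟩ := hgood
        by_cases hinj : Function.Injective c
        swap
        · exact hzero L c hc (bracket_eq_zero_of_not_injective Y hinj)
        by_cases hr : ∀ r, c r < B
        swap
        · push Not at hr
          exact hzero L c hc (hB c hr)
        obtain ⟨s, hs, hcs⟩ := hbad hinj hr
        obtain ⟨l, hl⟩ : ∃ l, L.Perm (c :: l) := ⟨_, List.perm_cons_erase hc⟩
        rw [(hl.map _).prod_eq]
        rw [hl.length_eq, (hl.map _).sum_eq] at hL₀
        rw [List.map_cons, List.prod_cons]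
        refine mul_mem_of_mem_span (bracket_mem_span_of_lt_card Y n hY hinj hs hcs) ?_
        rintro _ ⟨c', h1, rfl⟩
        rw [← List.prod_cons, ← List.map_cons]
        apply ih
        have := Nat.pow_lt_pow_left h1 (n := 2) (by norm_num)
        simp at hL₀ ⊢
        omega
  exact key (L.length * b ^ 2 + 1) L (by omega)

end Straightening

section Translation

/-- The columns of the generic matrix occurring in the selection `c`, numbered from one. -/
def colSet {k : ℕ} (n : ℕ) (c : Fin k → ℕ) : Finset ℕ :=
  (Finset.univ.filter fun r => c r < 2 * n).image fun r : Fin k => c r + 1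

/-- The rows, numbered from one, whose unit column does not occur in the selection `c`. -/
def rowSet {k : ℕ} (n : ℕ) (c : Fin k → ℕ) : Finset ℕ :=
  (Finset.univ.filter fun i : Fin k => ∀ r, c r ≠ 2 * n + (k - 1 - i)).image fun i : Fin k => (i : ℕ) + 1

/-- The one-line tableau of a column selection from the generic matrix extended by a reversed
identity block. -/
def tabOf {k : ℕ} (n : ℕ) (c : Fin k → ℕ) : List ℕ × List ℕ :=
  ((rowSet n c).sort, (colSet n c).sort)

lemma card_filter_colSet {k n : ℕ} {c : Fin k → ℕ} (hc : Function.Injective c) (t : ℕ) :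
    ((colSet n c).filter (· < t)).card = (Finset.univ.filter fun r => c r < min (t - 1) (2 * n)).card := by
  rw [colSet, Finset.filter_image, Finset.card_image_of_injective _ (fun a b h => hc (by simpa using h)),
    Finset.filter_filter]
  congr 1
  ext r
  simp
  omega

lemma card_filter_rowSet {k n : ℕ} {c : Fin k → ℕ} (hc : Function.Injective c)
    (hB : ∀ r, c r < 2 * n + k) (s : ℕ) :
    ((rowSet n c).filter (· < s)).card +
      (Finset.univ.filter fun r => ¬ c r < 2 * n + (k - (s - 1))).card = min (s - 1) k := by
  rw [rowSet, Finset.filter_image, Finset.card_image_of_injective _ (fun a b h => Fin.ext (by simpa using h)),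
    Finset.filter_filter]
  have h1 : (Finset.univ.filter fun r => ¬ c r < 2 * n + (k - (s - 1))).card =
      (Finset.univ.filter fun i : Fin k => (i : ℕ) + 1 < s ∧ ¬ ∀ r, c r ≠ 2 * n + (k - 1 - i)).card := by
    refine Finset.card_bij (fun r hr => ⟨2 * n + k - 1 - c r, by
      have := (Finset.mem_filter.1 hr).2
      have := hB r
      have := r.isLt
      omega⟩) ?_ ?_ ?_
    · intro r hr
      have := hB r
      simp at hr ⊢
      refine ⟨by omega, r, by omega⟩
    · intro a ha b hb hab
      have := hB a
      have := hB b
      simp at ha hb hab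
      exact hc (by omega)
    · intro i hi
      simp at hi
      obtain ⟨h, r, hr⟩ := hi
      have := i.isLt
      refine ⟨r, by simp; omega, Fin.ext (by simp; omega)⟩
  have h2 : (Finset.univ.filter fun i : Fin k => (i : ℕ) + 1 < s).card = min (s - 1) k := by
    rw [min_comm, ← Fin.card_filter_val_lt]
    exact congrArg Finset.card (Finset.filter_congr fun i _ => by omega)
  rw [h1, ← h2, ← Finset.card_filter_add_card_filter_not (s := Finset.univ.filter fun i : Fin k => (i : ℕ) + 1 < s)
    (fun i => ∀ r, c r ≠ 2 * n + (k - 1 - i)), Finset.filter_filter, Finset.filter_filter]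
  congr 3
  ext i
  exact and_comm

lemma card_colSet {k n : ℕ} {c : Fin k → ℕ} (hc : Function.Injective c) :
    (colSet n c).card = (Finset.univ.filter fun r => c r < 2 * n).card :=
  Finset.card_image_of_injective _ (fun a b h => hc (by simpa using h))

lemma mem_rowSet {k n : ℕ} {c : Fin k → ℕ} {x : ℕ} (hx : x ∈ rowSet n c) : 1 ≤ x ∧ x ≤ k := by
  simp [rowSet] at hx
  obtain ⟨i, _, rfl⟩ := hx
  omega

lemma mem_colSet {k n : ℕ} {c : Fin k → ℕ} {x : ℕ} (hx : x ∈ colSet n c) : 1 ≤ x ∧ x ≤ 2 * n := by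
  simp [colSet] at hx
  obtain ⟨i, _, rfl⟩ := hx
  omega

lemma card_rowSet_add {k n : ℕ} {c : Fin k → ℕ} (hc : Function.Injective c)
    (hB : ∀ r, c r < 2 * n + k) :
    (rowSet n c).card + (Finset.univ.filter fun r => ¬ c r < 2 * n).card = k := by
  have h := card_filter_rowSet hc hB (k + 1)
  rw [Finset.filter_true_of_mem (fun x hx => by have := mem_rowSet hx; omega)] at h
  simpa using h

lemma card_rowSet {k n : ℕ} {c : Fin k → ℕ} (hc : Function.Injective c)
    (hB : ∀ r, c r < 2 * n + k) : (rowSet n c).card = (colSet n c).card := by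
  have h := card_rowSet_add hc hB
  rw [card_colSet hc]
  have h2 := Finset.card_filter_add_card_filter_not (s := (Finset.univ : Finset (Fin k))) (fun r => c r < 2 * n)
  simp only [Finset.card_univ, Fintype.card_fin] at h2
  omega

lemma card_filter_lt_getElem_sort (s : Finset ℕ) {r : ℕ} (hr : r < s.sort.length) :
    (s.filter (· < s.sort[r])).card = r := by
  have hs := (Finset.sortedLT_sort s).pairwise
  have : s.filter (· < s.sort[r]) = (s.sort.take r).toFinset := by
    ext x
    rw [List.mem_toFinset, Finset.mem_filter, ← Finset.mem_sort (· ≤ ·), List.mem_take_iff_getElem,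
      List.mem_iff_getElem]
    constructor
    · rintro ⟨⟨i, hi, rfl⟩, hx⟩
      refine ⟨i, ?_, rfl⟩
      by_contra hcon
      have : r ≤ i := by omega
      rcases this.eq_or_lt with rfl | h
      · exact lt_irrefl _ hx
      · exact lt_asymm hx (List.pairwise_iff_getElem.1 hs r i hr hi h)
    · rintro ⟨i, hi, rfl⟩
      exact ⟨⟨i, by omega, rfl⟩, List.pairwise_iff_getElem.1 hs i r (by omega) hr (by omega)⟩
  rw [this, List.toFinset_card_of_nodup ((Finset.sort_nodup s _).sublist (List.take_sublist _ _))]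
  simp
  simpa using hr.le

lemma lt_card_filter_lt (s : Finset ℕ) {r t : ℕ} (hr : r < s.sort.length) (ht : s.sort[r] < t) :
    r < (s.filter (· < t)).card := by
  conv_lhs => rw [← card_filter_lt_getElem_sort s hr]
  apply Finset.card_lt_card
  rw [Finset.ssubset_iff_of_subset (Finset.monotone_filter_right _ fun x _ hx => lt_trans hx ht)]
  refine ⟨s.sort[r], ?_, by simp⟩
  rw [Finset.mem_filter, ← Finset.mem_sort (· ≤ ·) (s := s)]
  exact ⟨List.getElem_mem _, ht⟩

lemma sort_getD_le {s t : Finset ℕ}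
    (h : ∀ x, (t.filter (· < x)).card ≤ (s.filter (· < x)).card) {r : ℕ} (hr : r < t.card)
    (hs : r < s.card) : s.sort.getD r 0 ≤ t.sort.getD r 0 := by
  have hr' : r < t.sort.length := by simpa using hr
  have hs' : r < s.sort.length := by simpa using hs
  rw [List.getD_eq_getElem _ _ hr', List.getD_eq_getElem _ _ hs']
  by_contra! hlt
  have h1 := h (t.sort[r] + 1)
  have h2 := card_filter_lt_getElem_sort s hs'
  have h3 := lt_card_filter_lt t hr' (Nat.lt_add_one _)
  have h4 : (s.filter (· < t.sort[r] + 1)).card ≤ (s.filter (· < s.sort[r])).card :=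
    Finset.card_le_card (Finset.monotone_filter_right _ fun x _ hx => lt_of_lt_of_le hx hlt)
  omega

lemma tleq_tabOf {k n : ℕ} {c d : Fin k → ℕ} (hc : Function.Injective c)
    (hcB : ∀ r, c r < 2 * n + k) (hd : Function.Injective d) (hdB : ∀ r, d r < 2 * n + k)
    (h : colLE c d) : tleq (tabOf n c) (tabOf n d) := by
  have hle : (colSet n d).card ≤ (colSet n c).card := by
    rw [card_colSet hc, card_colSet hd]
    exact h _
  have e1 := card_rowSet hc hcB
  have e2 := card_rowSet hd hdB
  refine ⟨by simp [tabOf]; omega, fun r hr => ?_⟩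
  replace hr : r < (rowSet n d).card := by simpa [tabOf] using hr
  constructor
  · refine sort_getD_le (s := rowSet n c) (t := rowSet n d) (fun x => ?_) hr (by omega)
    have h1 := card_filter_rowSet hc hcB x
    have h2 := card_filter_rowSet hd hdB x
    have h3 := h (2 * n + (k - (x - 1)))
    have h4 := Finset.card_filter_add_card_filter_not (s := (Finset.univ : Finset (Fin k)))
      (fun r => c r < 2 * n + (k - (x - 1)))
    have h5 := Finset.card_filter_add_card_filter_not (s := (Finset.univ : Finset (Fin k)))
      (fun r => d r < 2 * n + (k - (x - 1)))
    omega
  · refine sort_getD_le (s := colSet n c) (t := colSet n d) (fun x => ?_) (by omega) (by omega)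
    rw [card_filter_colSet hc, card_filter_colSet hd]
    exact h _

lemma isTabN_tabOf {k n : ℕ} {c : Fin k → ℕ} (hc : Function.Injective c)
    (hcB : ∀ r, c r < 2 * n + k)
    (hs : ∀ s ≤ n, (Finset.univ.filter fun r => c r < 2 * s).card ≤ s)
    (h0 : (tabOf n c).1 ≠ []) : isTabN k n (tabOf n c).1 (tabOf n c).2 := by
  have e := card_rowSet hc hcB
  have hn : (colSet n c).card ≤ n := by
    rw [card_colSet hc]
    exact hs n le_rfl
  have hk := card_rowSet_add hc hcB
  refine ⟨⟨by simpa [tabOf] using e, h0, ?_, ?_, ?_, ?_⟩, ?_, ?_, ?_⟩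
  · exact List.isChain_iff_pairwise.2 (Finset.sortedLT_sort (rowSet n c)).pairwise
  · exact List.isChain_iff_pairwise.2 (Finset.sortedLT_sort (colSet n c)).pairwise
  · intro x hx
    exact mem_rowSet ((Finset.mem_sort _).1 hx)
  · intro x hx
    exact mem_colSet ((Finset.mem_sort _).1 hx)
  · simp [tabOf]
    omega
  · simpa [tabOf] using hn
  · intro r hr
    by_contra! hlt
    have hr' : r < (colSet n c).card := by simpa [tabOf] using hr
    have h1 := hs r (by omega)
    have h2 := card_filter_colSet (n := n) hc (2 * r + 1)
    rw [show min (2 * r + 1 - 1) (2 * n) = 2 * r by omega] at h2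
    rw [List.getD_eq_getElem _ _ hr] at hlt
    have h3 := lt_card_filter_lt (colSet n c) hr hlt
    omega

/-- The generic matrix over the quotient ring, extended by a reversed identity block. -/
def extMatrix (k n : ℕ) : Matrix (Fin k) ℕ (MvPolynomial (Fin k × Fin (2 * n)) ℂ ⧸ sympIdeal k n) :=
  Matrix.of fun i j =>
    if h : j < 2 * n then Ideal.Quotient.mk _ (MvPolynomial.X (i, ⟨j, h⟩))
    else if j = 2 * n + (k - 1 - i) then 1 else 0

lemma extMatrix_of_lt {k n : ℕ} (i : Fin k) {j : ℕ} (h : j < 2 * n) :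
    extMatrix k n i j = Ideal.Quotient.mk _ (MvPolynomial.X (i, ⟨j, h⟩)) := by
  simp [extMatrix, h]

lemma extMatrix_of_le {k n : ℕ} (i : Fin k) {j : ℕ} (h : 2 * n ≤ j) :
    extMatrix k n i j = if j = 2 * n + (k - 1 - i) then 1 else 0 := by
  simp [extMatrix, h]

lemma mk_rbase_eq_zero (k n : ℕ) (i j : Fin k) :
    Ideal.Quotient.mk (sympIdeal k n) (rbase k n i j) = 0 := by
  have h : ∀ i j : Fin k, i < j → Ideal.Quotient.mk (sympIdeal k n) (rbase k n i j) = 0 :=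
    fun i j hij => Ideal.Quotient.eq_zero_iff_mem.2 (Ideal.subset_span ⟨i, j, hij, rfl⟩)
  rcases lt_trichotomy i j with hij | rfl | hij
  · exact h i j hij
  · simp [rbase]
  · have : rbase k n i j = - rbase k n j i := by
      simp [rbase]
    rw [this, map_neg, h j i hij, neg_zero]

lemma extMatrix_isotropic (k n : ℕ) (i j : Fin k) :
    ∑ u ∈ Finset.range n, (extMatrix k n i (2 * u) * extMatrix k n j (2 * u + 1) -
      extMatrix k n j (2 * u) * extMatrix k n i (2 * u + 1)) = 0 := by
  rw [← mk_rbase_eq_zero k n i j, rbase, map_sum, Finset.sum_range]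
  refine Finset.sum_congr rfl fun u _ => ?_
  have := u.isLt
  rw [extMatrix_of_lt i (j := 2 * u) (by omega), extMatrix_of_lt j (j := 2 * u) (by omega),
    extMatrix_of_lt i (j := 2 * u + 1) (by omega), extMatrix_of_lt j (j := 2 * u + 1) (by omega)]
  simp

lemma bracket_extMatrix_eq_zero {k n : ℕ} {c : Fin k → ℕ} (h : ∃ r, 2 * n + k ≤ c r) :
    bracket (extMatrix k n) c = 0 := by
  obtain ⟨r, hr⟩ := h
  refine Matrix.det_eq_zero_of_column_eq_zero r fun i => ?_
  rw [Matrix.submatrix_apply, extMatrix_of_le _ (by omega), if_neg]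
  have := i.isLt
  omega

lemma det_submatrix_equiv_equiv {ι κ R : Type*} [Fintype ι] [DecidableEq ι] [Fintype κ] [DecidableEq κ]
    [CommRing R] (M : Matrix κ κ R) (e f : ι ≃ κ) :
    (M.submatrix e f).det = ((Equiv.Perm.sign (e.symm.trans f) : ℤ) : R) * M.det := by
  rw [← Matrix.det_permute', ← Matrix.det_submatrix_equiv_self e]
  congr 1
  ext i j
  simp

lemma exists_bracket_extMatrix_eq {k n : ℕ} {c : Fin k → ℕ} (hc : Function.Injective c)
    (hcB : ∀ r, c r < 2 * n + k) :
    ∃ ε : ℤ, bracket (extMatrix k n) c =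
      ε * Ideal.Quotient.mk (sympIdeal k n) (dmin k (2 * n) (tabOf n c).1 (tabOf n c).2) := by
  set I := (tabOf n c).1 with hI
  set J := (tabOf n c).2 with hJ
  have hlen : I.length = J.length := by simpa [hI, hJ, tabOf] using card_rowSet hc hcB
  have hcard : I.length + (Finset.univ.filter fun r => ¬ c r < 2 * n).card = k := by
    simpa [hI, tabOf] using card_rowSet_add hc hcB
  have hImem : ∀ a : Fin I.length, ∃ i : Fin k, (∀ r, c r ≠ 2 * n + (k - 1 - i)) ∧
      (i : ℕ) + 1 = I.getD a 0 := by
    intro a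
    have : I.getD a 0 ∈ rowSet n c := by
      rw [List.getD_eq_getElem _ _ a.isLt]
      exact (Finset.mem_sort _).1 (List.getElem_mem _)
    simpa [rowSet] using this
  have hJmem : ∀ a : Fin I.length, ∃ r : Fin k, c r < 2 * n ∧ c r + 1 = J.getD a 0 := by
    intro a
    have : J.getD a 0 ∈ colSet n c := by
      rw [List.getD_eq_getElem _ _ (hlen ▸ a.isLt)]
      exact (Finset.mem_sort _).1 (List.getElem_mem _)
    simpa [colSet] using this
  choose e₁ he₁ he₁' using hImem
  choose f₁ hf₁ hf₁' using hJmem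
  have hIinj : ∀ a b : Fin I.length, I.getD a 0 = I.getD b 0 → a = b := by
    intro a b hab
    rw [List.getD_eq_getElem _ _ a.isLt, List.getD_eq_getElem _ _ b.isLt] at hab
    exact Fin.ext ((List.Nodup.getElem_inj_iff (Finset.sort_nodup (rowSet n c) _)).1 hab)
  have hJinj : ∀ a b : Fin I.length, J.getD a 0 = J.getD b 0 → a = b := by
    intro a b hab
    rw [List.getD_eq_getElem _ _ (hlen ▸ a.isLt), List.getD_eq_getElem _ _ (hlen ▸ b.isLt)] at hab
    exact Fin.ext ((List.Nodup.getElem_inj_iff (Finset.sort_nodup (colSet n c) _)).1 hab)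
  have hcardS : Fintype.card (Fin I.length ⊕ {r // ¬ c r < 2 * n}) = Fintype.card (Fin k) := by
    rw [Fintype.card_sum, Fintype.card_subtype, Fintype.card_fin, Fintype.card_fin, hcard]
  let e₀ : Fin I.length ⊕ {r // ¬ c r < 2 * n} → Fin k :=
    Sum.elim e₁ fun q => ⟨2 * n + k - 1 - c q, by have := hcB q; have := q.2; have := q.1.isLt; omega⟩
  let f₀ : Fin I.length ⊕ {r // ¬ c r < 2 * n} → Fin k := Sum.elim f₁ fun q => q
  have he₀ : Function.Bijective e₀ := by
    refine (Fintype.bijective_iff_injective_and_card _).2 ⟨?_, hcardS⟩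
    refine Function.Injective.sumElim (fun a b hab => hIinj a b ?_) (fun q q' h => ?_) (fun a q h => ?_)
    · rw [← he₁', ← he₁', hab]
    · have := hcB q
      have := hcB q'
      have := q.2
      have := q'.2
      simp only [Fin.mk.injEq] at h
      exact Subtype.ext (hc (by omega))
    · have := hcB q
      have := q.2
      refine he₁ a q ?_
      rw [h]
      simp only
      omega
  have hf₀ : Function.Bijective f₀ := by
    refine (Fintype.bijective_iff_injective_and_card _).2 ⟨?_, hcardS⟩
    refine Function.Injective.sumElim (fun a b hab => hJinj a b ?_) Subtype.val_injective (fun a q h => ?_)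
    · rw [← hf₁', ← hf₁', hab]
    · exact q.2 (h ▸ hf₁ a)
  let e := Equiv.ofBijective e₀ he₀
  let f := Equiv.ofBijective f₀ hf₀
  have hdet := det_submatrix_equiv_equiv ((extMatrix k n).submatrix id c) e f
  have hblock : (((extMatrix k n).submatrix id c).submatrix e f).det =
      Ideal.Quotient.mk (sympIdeal k n) (dmin k (2 * n) I J) := by
    rw [← Matrix.fromBlocks_toBlocks (((extMatrix k n).submatrix id c).submatrix e f)]
    have h12 : (((extMatrix k n).submatrix id c).submatrix e f).toBlocks₁₂ = 0 := by
      ext a q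
      change extMatrix k n (e₁ a) (c q) = 0
      rw [extMatrix_of_le _ (not_lt.1 q.2), if_neg (he₁ a q)]
    have h22 : (((extMatrix k n).submatrix id c).submatrix e f).toBlocks₂₂ = 1 := by
      ext q q'
      change extMatrix k n (e₀ (Sum.inr q)) (c q') = _
      rw [extMatrix_of_le _ (not_lt.1 q'.2), Matrix.one_apply]
      have := hcB q
      have := hcB q'
      have := q.2
      refine if_congr ?_ rfl rfl
      simp only [e₀, Sum.elim_inr]
      rw [Subtype.ext_iff, ← hc.eq_iff]
      omega
    have h11 : (((extMatrix k n).submatrix id c).submatrix e f).toBlocks₁₁ =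
        (Ideal.Quotient.mk (sympIdeal k n)).mapMatrix (Matrix.of fun a b : Fin I.length =>
          if h : I.getD a 0 - 1 < k ∧ J.getD b 0 - 1 < 2 * n then
            MvPolynomial.X (⟨I.getD a 0 - 1, h.1⟩, ⟨J.getD b 0 - 1, h.2⟩)
          else 0) := by
      ext a b
      have h1 := he₁' a
      have h2 := hf₁' b
      have h3 := hf₁ b
      have h4 := (e₁ a).isLt
      change extMatrix k n (e₁ a) (c (f₁ b)) = _
      rw [extMatrix_of_lt _ h3, RingHom.mapMatrix_apply, Matrix.map_apply, Matrix.of_apply,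
        dif_pos ⟨by omega, by omega⟩]
      congr 3
      · exact Fin.ext (by simp only; omega)
      · exact Fin.ext (by simp only; omega)
    rw [h12, h22, h11, Matrix.det_fromBlocks_zero₁₂, Matrix.det_one, mul_one, ← RingHom.map_det, dmin]
  rw [hblock] at hdet
  refine ⟨Equiv.Perm.sign (e.symm.trans f), ?_⟩
  rw [hdet, ← mul_assoc, ← Int.cast_mul, ← Units.val_mul, Int.units_mul_self]
  simp [bracket]

lemma exists_bracket_eq_mk_X {k n : ℕ} (i : Fin k) (j : Fin (2 * n)) :
    ∃ c : Fin k → ℕ, Ideal.Quotient.mk (sympIdeal k n) (MvPolynomial.X (i, j)) =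
      bracket (extMatrix k n) c := by
  refine ⟨Function.update (fun r => 2 * n + (k - 1 - r)) i j, ?_⟩
  have h : (extMatrix k n).submatrix id (Function.update (fun r : Fin k => 2 * n + (k - 1 - r)) i j) =
      (1 : Matrix (Fin k) (Fin k) _).updateCol i fun l => extMatrix k n l j := by
    ext a b
    by_cases hb : b = i
    · subst hb
      simp
    · rw [Matrix.submatrix_apply, Function.update_of_ne hb, Matrix.updateCol_ne hb,
        extMatrix_of_le _ (by omega), Matrix.one_apply]
      refine if_congr ?_ rfl rfl
      rw [Fin.ext_iff, id]
      omega
  rw [bracket, h, ← Matrix.cramer_apply, Matrix.cramer_one]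
  exact (extMatrix_of_lt i j.isLt).symm

lemma exists_list_prod_bracket_eq {k n : ℕ} (L : List (Fin k → ℕ))
    (hL : ∀ c ∈ L, Function.Injective c ∧ ∀ r, c r < 2 * n + k) :
    ∃ ε : ℤ, (L.map (bracket (extMatrix k n))).prod = ε * Ideal.Quotient.mk (sympIdeal k n)
      ((((L.map (tabOf n)).filter (·.1 ≠ [])).map fun t => dmin k (2 * n) t.1 t.2).prod) := by
  induction L with
  | nil => exact ⟨1, by simp⟩
  | cons c L ih =>
    obtain ⟨ε, h⟩ := ih fun d hd => hL d (by simp [hd])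
    obtain ⟨hc, hcB⟩ := hL c (by simp)
    obtain ⟨η, hη⟩ := exists_bracket_extMatrix_eq hc hcB
    refine ⟨η * ε, ?_⟩
    rw [List.map_cons, List.prod_cons, h, hη, List.map_cons]
    by_cases h0 : (tabOf n c).1 = []
    · have h1 : dmin k (2 * n) (tabOf n c).1 (tabOf n c).2 = 1 := by
        rw [h0]
        exact Matrix.det_fin_zero
      rw [h1, List.filter_cons_of_neg (by simp [h0])]
      push_cast
      simp [mul_assoc]
    · rw [List.filter_cons_of_pos (by simp [h0])]
      push_cast
      simp only [List.map_cons, List.prod_cons, map_mul]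
      ring

/-- The standard monomials span the quotient by the symplectic ideal. -/
theorem span_standardMonomials (k n : ℕ) :
    Submodule.span ℂ {f : MvPolynomial (Fin k × Fin (2 * n)) ℂ ⧸ sympIdeal k n |
      ∃ L : List (List ℕ × List ℕ), (∀ t ∈ L, isTabN k n t.1 t.2) ∧ L.Chain' tleq ∧
        f = Ideal.Quotient.mk (sympIdeal k n)
          ((L.map fun t => dmin k (2 * n) t.1 t.2).prod)} = ⊤ := by
  set V := Submodule.span ℂ {f : MvPolynomial (Fin k × Fin (2 * n)) ℂ ⧸ sympIdeal k n |
      ∃ L : List (List ℕ × List ℕ), (∀ t ∈ L, isTabN k n t.1 t.2) ∧ L.Chain' tleq ∧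
        f = Ideal.Quotient.mk (sympIdeal k n)
          ((L.map fun t => dmin k (2 * n) t.1 t.2).prod)} with hV
  have hbracket : ∀ L : List (Fin k → ℕ), (L.map (bracket (extMatrix k n))).prod ∈ V := by
    refine list_prod_bracket_mem _ n (2 * n + k) (extMatrix_isotropic k n)
      (fun c => bracket_extMatrix_eq_zero) V fun L hL hpair => ?_
    obtain ⟨ε, h⟩ := exists_list_prod_bracket_eq L fun c hc => ⟨(hL c hc).1, (hL c hc).2.1⟩
    rw [h, ← zsmul_eq_mul]
    suffices hm : Ideal.Quotient.mk (sympIdeal k n)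
        ((((L.map (tabOf n)).filter (·.1 ≠ [])).map fun t => dmin k (2 * n) t.1 t.2).prod) ∈ V from
      zsmul_mem hm ε
    refine Submodule.subset_span ⟨_, fun t ht => ?_, ?_, rfl⟩
    · obtain ⟨ht, h0⟩ := List.mem_filter.1 ht
      obtain ⟨c, hc, rfl⟩ := List.mem_map.1 ht
      obtain ⟨h1, h2, h3⟩ := hL c hc
      exact isTabN_tabOf h1 h2 h3 (by simpa using h0)
    · refine List.isChain_iff_pairwise.2 (List.Pairwise.filter _ ?_)
      rw [List.pairwise_map]
      refine hpair.imp_of_mem fun {c d} hc hd h => ?_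
      exact tleq_tabOf (hL c hc).1 (hL c hc).2.1 (hL d hd).1 (hL d hd).2.1 h
  have key : ∀ p : MvPolynomial (Fin k × Fin (2 * n)) ℂ, ∀ L : List (Fin k → ℕ),
      Ideal.Quotient.mk (sympIdeal k n) p * (L.map (bracket (extMatrix k n))).prod ∈ V := by
    intro p
    induction p using MvPolynomial.induction_on with
    | C a =>
      intro L
      obtain ⟨q, hq⟩ := Ideal.Quotient.mk_surjective ((L.map (bracket (extMatrix k n))).prod)
      rw [← hq, ← map_mul, ← MvPolynomial.smul_eq_C_mul]
      exact V.smul_mem a (hq ▸ hbracket L)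
    | add p q hp hq =>
      intro L
      rw [map_add, add_mul]
      exact add_mem (hp L) (hq L)
    | mul_X p x hp =>
      intro L
      obtain ⟨c, hc⟩ := exists_bracket_eq_mk_X (k := k) (n := n) x.1 x.2
      rw [map_mul, hc, mul_assoc, ← List.prod_cons, ← List.map_cons]
      exact hp _
  refine eq_top_iff.2 fun f _ => ?_
  obtain ⟨p, rfl⟩ := Ideal.Quotient.mk_surjective f
  simpa using key p []

end Translation

/-- Theorem `standardmonomialN`. The images in
`R(𝒩_{k,2n}) = ℂ[M_{k,2n}]/I` of the `𝒩`-standard monomials `Δ(t)`, for `t` ranging over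
all `𝒩`-standard tableaux (multichains in `D(𝒩)`, including the empty one), form a ℂ-basis:
they are linearly independent and span. -/
theorem N_standard_monomials_basis (k n : ℕ) (hk : 0 < k) (hn : 0 < n) :
    LinearIndependent ℂ
      (fun L : {L : List (List ℕ × List ℕ) //
          (∀ t ∈ L, isTabN k n t.1 t.2) ∧ L.Chain' tleq} =>
        Ideal.Quotient.mk (sympIdeal k n)
          (((L : List (List ℕ × List ℕ)).map fun t => dmin k (2 * n) t.1 t.2).prod)) ∧
    Submodule.span ℂ {f : MvPolynomial (Fin k × Fin (2 * n)) ℂ ⧸ sympIdeal k n |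
      ∃ L : List (List ℕ × List ℕ), (∀ t ∈ L, isTabN k n t.1 t.2) ∧ L.Chain' tleq ∧
        f = Ideal.Quotient.mk (sympIdeal k n)
          ((L.map fun t => dmin k (2 * n) t.1 t.2).prod)} = ⊤ := by
  exact ⟨linearIndependent_standardMonomials k n, span_standardMonomials k n⟩

end
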